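/- arXiv:2012.00712 — 2 statements merged into one kernel-verified Lean document; each statement's English description precedes it below -/
import Mathlib

section
/- The residue of the Minkowski-signature integral at its poles equals i times the Euclidean residue: for n even, k ∈ {1,...,n/2}, and Im u > 0, Res_{α=k} ∫_{ℝⁿ} (-x₁² + x₂² + ... + xₙ² - u - i0)^{-α} dx = i · Res_{α=k} ∫_{ℝⁿ} (‖x‖² - u)^{-α} dx = i π^{n/2} u^{n/2-k} / (Γ(k) (n/2 - k)!). -/
open Real MeasureTheory Set Filter Topology

lemma aux_int (s : ℝ) (hs : -1 < s) (b : ℝ) (hb : 0 < b) :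
    IntegrableOn (fun t : ℝ => t ^ s * Real.exp (-b * t)) (Ioi 0) := by
  have := integrableOn_rpow_mul_exp_neg_mul_rpow hs one_pos hb
  simpa using this

lemma aux_norm (a r : ℂ) (t : ℝ) (ht : 0 < t) :
    ‖(t : ℂ) ^ (a - 1) * Complex.exp (-r * t)‖ = t ^ (a.re - 1) * Real.exp (-r.re * t) := by
  rw [norm_mul, Complex.norm_cpow_eq_rpow_re_of_pos ht, Complex.norm_exp]
  simp

lemma aux_cint (a : ℂ) (ha : 0 < a.re) (r : ℂ) (hr : 0 < r.re) :
    IntegrableOn (fun t : ℝ => (t : ℂ) ^ (a - 1) * Complex.exp (-r * t)) (Ioi 0) := by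
  refine (aux_int (a.re - 1) (by linarith) r.re hr).mono' ?_ ?_
  · exact Measurable.aestronglyMeasurable (by fun_prop)
  · filter_upwards [ae_restrict_mem measurableSet_Ioi] with t ht
    exact (aux_norm a r t ht).le

lemma aux_gamma (a : ℂ) (ha : 0 < a.re) (r : ℂ) (hr : 0 < r.re) :
    ∫ t : ℝ in Ioi 0, (t : ℂ) ^ (a - 1) * Complex.exp (-r * t) = r ^ (-a) * Complex.Gamma a := by
  have hopen : IsOpen {z : ℂ | 0 < z.re} := isOpen_lt continuous_const Complex.continuous_re
  have hd : DifferentiableOn ℂ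
      (fun z : ℂ => ∫ t : ℝ in Ioi 0, (t : ℂ) ^ (a - 1) * Complex.exp (-z * t))
      {z : ℂ | 0 < z.re} := by
    intro z hz
    have hz' : 0 < z.re := hz
    refine DifferentiableAt.differentiableWithinAt (HasDerivAt.differentiableAt (f' := ∫ t : ℝ in Ioi 0, (t : ℂ) ^ (a - 1) * (Complex.exp (-z * t) * (- t))) ?_)
    refine (hasDerivAt_integral_of_dominated_loc_of_deriv_le
      (F := fun z (t : ℝ) => (t : ℂ) ^ (a - 1) * Complex.exp (-z * t))
      (F' := fun z (t : ℝ) => (t : ℂ) ^ (a - 1) * (Complex.exp (-z * t) * (- t)))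
      (s := {y : ℂ | z.re / 2 < y.re})
      (bound := fun t => t ^ a.re * Real.exp (-(z.re / 2) * t)) ?_ ?_ ?_ ?_ ?_ ?_ ?_).2
    · exact (isOpen_lt continuous_const Complex.continuous_re).mem_nhds (by simp; linarith)
    · exact Eventually.of_forall fun y => Measurable.aestronglyMeasurable (by fun_prop)
    · exact aux_cint a ha z hz
    · exact Measurable.aestronglyMeasurable (by fun_prop)
    · filter_upwards [ae_restrict_mem measurableSet_Ioi] with t ht y hy
      have ht : 0 < t := ht
      have hy : z.re / 2 < y.re := hy
      rw [← mul_assoc, norm_mul, aux_norm a y t ht, norm_neg, Complex.norm_real, Real.norm_eq_abs,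
        abs_of_pos ht]
      have : t ^ a.re = t ^ (a.re - 1) * t := by
        rw [← Real.rpow_add_one ht.ne']; simp
      rw [this]
      have h2 : Real.exp (-y.re * t) ≤ Real.exp (-(z.re / 2) * t) := by
        apply Real.exp_le_exp.2; nlinarith
      have h3 : 0 ≤ t ^ (a.re - 1) := by positivity
      calc _ = t ^ (a.re - 1) * t * Real.exp (-y.re * t) := by ring
        _ ≤ _ := by gcongr
    · exact aux_int _ (by linarith) _ (by linarith)
    · refine Eventually.of_forall fun t y _ => ?_
      have h1 : HasDerivAt (fun y : ℂ => -y * (t : ℂ)) (-t) y := by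
        simpa using (hasDerivAt_id y).neg.mul_const (t : ℂ)
      exact h1.cexp.const_mul _
  have hd2 : DifferentiableOn ℂ (fun z : ℂ => z ^ (-a) * Complex.Gamma a) {z : ℂ | 0 < z.re} := by
    intro z hz
    have : z ∈ Complex.slitPlane := Or.inl hz
    exact ((differentiableAt_id.cpow_const this).mul_const _).differentiableWithinAt
  have hpre : IsPreconnected {z : ℂ | 0 < z.re} := (convex_halfSpace_re_gt 0).isPreconnected
  have key := (hd.analyticOnNhd hopen).eqOn_of_preconnected_of_frequently_eq
    (hd2.analyticOnNhd hopen) hpre (z₀ := 1) (by simp) ?_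
  · exact key hr
  · have ht : Tendsto (fun x : ℝ => (x : ℂ)) (𝓝[>] 1) (𝓝[≠] 1) := by
      refine tendsto_nhdsWithin_iff.2 ⟨?_, ?_⟩
      · have := (Complex.continuous_ofReal.tendsto 1).mono_left (nhdsWithin_le_nhds (s := Ioi 1))
        simpa using this
      · filter_upwards [self_mem_nhdsWithin] with x hx
        have : (1 : ℝ) < x := hx
        simp; exact_mod_cast this.ne'
    refine ht.frequently (Eventually.frequently ?_)
    filter_upwards [self_mem_nhdsWithin] with x hx
    have hx : (1 : ℝ) < x := hx
    have h0 : 0 < x := by linarith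
    have := Complex.integral_cpow_mul_exp_neg_mul_Ioi ha h0
    simp only [neg_mul]
    rw [this, one_div, Complex.inv_cpow, Complex.cpow_neg]
    rw [Complex.arg_ofReal_of_nonneg h0.le]; exact Real.pi_pos.ne

/-- residue of Gamma -/
lemma aux_res (m : ℕ) : Tendsto (fun z : ℂ => (z + m) * Complex.Gamma z) (𝓝[≠] (-(m : ℂ)))
    (𝓝 ((-1) ^ m / (m.factorial : ℂ))) := by
  induction m with
  | zero => simpa using Complex.tendsto_self_mul_Gamma_nhds_zero
  | succ m ih =>
    have h1 : Tendsto (fun z : ℂ => z + 1) (𝓝[≠] (-((m + 1 : ℕ) : ℂ))) (𝓝[≠] (-(m : ℂ))) := by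
      refine tendsto_nhdsWithin_iff.2 ⟨?_, ?_⟩
      · have : Continuous (fun z : ℂ => z + 1) := by fun_prop
        have := (this.tendsto (-((m + 1 : ℕ) : ℂ))).mono_left (nhdsWithin_le_nhds (s := {(-((m + 1 : ℕ) : ℂ))}ᶜ))
        simpa using this
      · filter_upwards [self_mem_nhdsWithin] with x hx
        intro h
        apply hx
        have h : x + 1 = -(m : ℂ) := h
        simp only [mem_singleton_iff]
        push_cast
        linear_combination h
    have hne : (-((m + 1 : ℕ) : ℂ)) ≠ 0 := by
      rw [neg_ne_zero]; exact_mod_cast m.succ_ne_zero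
    have h2 : Tendsto (fun z : ℂ => z) (𝓝[≠] (-((m + 1 : ℕ) : ℂ))) (𝓝 (-((m + 1 : ℕ) : ℂ))) :=
      nhdsWithin_le_nhds
    have h3 := (ih.comp h1).div h2 hne
    have e : (-1 : ℂ) ^ m / (m.factorial : ℂ) / (-((m + 1 : ℕ) : ℂ)) =
        (-1) ^ (m + 1) / ((m + 1).factorial : ℂ) := by
      rw [Nat.factorial_succ, pow_succ]
      have : (m.factorial : ℂ) ≠ 0 := by exact_mod_cast m.factorial_ne_zero
      have : ((m + 1 : ℕ) : ℂ) ≠ 0 := by exact_mod_cast m.succ_ne_zero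
      push_cast at *
      field_simp
    rw [e] at h3
    refine h3.congr' ?_
    have : ∀ᶠ z in 𝓝[≠] (-((m + 1 : ℕ) : ℂ)), z ≠ 0 := h2.eventually_ne hne
    filter_upwards [this] with z hz
    simp only [Function.comp, Pi.div_apply]
    rw [Complex.Gamma_add_one z hz]
    push_cast
    field_simp
    ring

lemma aux_part2 (p : ℕ) (u : ℂ) (hu : 0 < u.im)
    (k : ℕ) (hk1 : 1 ≤ k) (hkp : k ≤ p) :
    Tendsto (fun α : ℂ => (α - (k : ℂ)) *
        (Complex.I * ((π : ℂ) ^ p * Complex.Gamma (α - (p : ℂ)) / Complex.Gamma α *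
          (-u) ^ ((p : ℂ) - α))))
      (𝓝[≠] (k : ℂ))
      (𝓝 (Complex.I * (π : ℂ) ^ p * u ^ (p - k) /
        (Complex.Gamma (k : ℂ) * ((p - k).factorial : ℂ)))) := by
  obtain ⟨m, rfl⟩ := Nat.exists_eq_add_of_le hkp
  have hu0 : -u ≠ 0 := by
    intro h
    have : u = 0 := by simpa using h
    simp [this] at hu
  have hk0 : 0 < (k : ℂ).re := by simp; omega
  have hG : Complex.Gamma (k : ℂ) ≠ 0 := Complex.Gamma_ne_zero_of_re_pos hk0
  have h1 : Tendsto (fun z : ℂ => z - (k + m : ℕ)) (𝓝[≠] (k : ℂ)) (𝓝[≠] (-(m : ℂ))) := by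
    refine tendsto_nhdsWithin_iff.2 ⟨?_, ?_⟩
    · have : Continuous (fun z : ℂ => z - (k + m : ℕ)) := by fun_prop
      have := (this.tendsto (k : ℂ)).mono_left (nhdsWithin_le_nhds (s := {(k : ℂ)}ᶜ))
      simpa using this
    · filter_upwards [self_mem_nhdsWithin] with x hx
      intro h
      apply hx
      have h : x - (k + m : ℕ) = -(m : ℂ) := h
      push_cast at h
      simp only [mem_singleton_iff]
      linear_combination h
  have h2 := (aux_res m).comp h1
  have h3 : Tendsto Complex.Gamma (𝓝[≠] (k : ℂ)) (𝓝 (Complex.Gamma k)) := by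
    refine Tendsto.mono_left ?_ nhdsWithin_le_nhds
    refine (Complex.differentiableAt_Gamma _ ?_).continuousAt
    intro j h
    have := congrArg Complex.re h
    simp at this
    simp at hk0
    have hj : (0 : ℝ) ≤ j := by positivity
    have hk0 : (0 : ℝ) < k := by exact_mod_cast hk0
    linarith
  have h4 : Tendsto (fun z : ℂ => (-u) ^ (((k + m : ℕ) : ℂ) - z)) (𝓝[≠] (k : ℂ))
      (𝓝 ((-u) ^ m)) := by
    have : Continuous (fun z : ℂ => (-u) ^ (((k + m : ℕ) : ℂ) - z)) := by
      refine Continuous.const_cpow (by fun_prop) (Or.inl hu0)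
    have := (this.tendsto (k : ℂ)).mono_left (nhdsWithin_le_nhds (s := {(k : ℂ)}ᶜ))
    simpa using this
  have h5 := ((h2.div h3 hG).mul h4).const_mul (Complex.I * (π : ℂ) ^ (k + m))
  have e : (Complex.I * (π : ℂ) ^ (k + m)) * ((-1) ^ m / (m.factorial : ℂ) / Complex.Gamma k * (-u) ^ m)
      = Complex.I * (π : ℂ) ^ (k + m) * u ^ (k + m - k) /
        (Complex.Gamma (k : ℂ) * ((k + m - k).factorial : ℂ)) := by
    rw [Nat.add_sub_cancel_left, neg_pow u]
    have : ((-1 : ℂ) ^ m) * (-1) ^ m = 1 := by rw [← mul_pow]; simp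
    have hm : (m.factorial : ℂ) ≠ 0 := by exact_mod_cast m.factorial_ne_zero
    field_simp
    linear_combination u ^ m * this
  rw [e] at h5
  refine h5.congr fun z => ?_
  simp only [Function.comp, Pi.div_apply]
  push_cast
  ring

lemma aux_cpow (φ : ℝ) (z s : ℂ) (hz : z ≠ 0) (h1 : -π < φ + z.arg) (h2 : φ + z.arg ≤ π) :
    (Complex.exp (φ * Complex.I) * z) ^ s = Complex.exp (φ * Complex.I * s) * z ^ s := by
  have h : Complex.log (Complex.exp (φ * Complex.I) * z) = φ * Complex.I + Complex.log z := by
    nth_rw 1 [← Complex.exp_log hz]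
    rw [← Complex.exp_add, Complex.log_exp] <;> simpa [Complex.log_im]
  rw [Complex.cpow_def_of_ne_zero (mul_ne_zero (Complex.exp_ne_zero _) hz),
    Complex.cpow_def_of_ne_zero hz, h, ← Complex.exp_add]
  ring_nf

lemma aux_rot_re (φ : ℝ) (z : ℂ) (hz : z ≠ 0) (h1 : -(π / 2) < φ + z.arg) (h2 : φ + z.arg < π / 2) :
    0 < (Complex.exp (φ * Complex.I) * z).re := by
  nth_rw 1 [← Complex.exp_log hz]
  rw [← Complex.exp_add, Complex.exp_re]
  refine mul_pos (Real.exp_pos _) (Real.cos_pos_of_mem_Ioo ?_)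
  constructor <;> simpa [Complex.log_im]

lemma aux_rmul (r : ℝ) (hr : 0 < r) (z s : ℂ) (hz : z ≠ 0) :
    ((r : ℂ) * z) ^ s = (r : ℂ) ^ s * z ^ s := by
  have h : (r : ℂ) ≠ 0 := by exact_mod_cast hr.ne'
  rw [Complex.cpow_def_of_ne_zero (mul_ne_zero h hz), Complex.cpow_def_of_ne_zero h,
    Complex.cpow_def_of_ne_zero hz, Complex.log_ofReal_mul hr hz, ← Complex.exp_add,
    Complex.ofReal_log hr.le, add_mul]

lemma aux_sqrt_pow {p : ℕ} (t : ℝ) :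
    ((t : ℂ)⁻¹ ^ (1 / 2 : ℂ)) ^ (2 * p) = (t : ℂ) ^ (-(p : ℂ)) := by
  have h : ((t : ℂ)⁻¹ ^ (1 / 2 : ℂ)) ^ 2 = (t : ℂ)⁻¹ := by
    rw [← Complex.cpow_nat_mul]; simp
  rw [pow_mul, h, Complex.cpow_neg, Complex.cpow_natCast, inv_pow]

lemma aux_main (p : ℕ) (b : Fin (2 * p) → ℂ) (hb : ∀ i, 0 < (b i).re) (c : ℂ) (hc : 0 < c.re)
    (α : ℂ) (hα : (p : ℝ) < α.re) :
    (∫ x : Fin (2 * p) → ℝ, (∑ i, b i * ((x i : ℝ) : ℂ) ^ 2 + c) ^ (-α)) * Complex.Gamma α =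
      (∏ i, (π / b i) ^ (1 / 2 : ℂ)) * (c ^ ((p : ℂ) - α) * Complex.Gamma (α - p)) := by
  have hα0 : 0 < α.re := lt_of_le_of_lt (by positivity) hα
  set f : ℝ → (Fin (2 * p) → ℝ) → ℂ := fun t x =>
    ((t : ℂ) ^ (α - 1) * Complex.exp (-c * t)) *
      ∏ i, Complex.exp (-(t * b i) * ((x i : ℝ) : ℂ) ^ 2) with hf
  have hre : ∀ t : ℝ, 0 < t → ∀ i, 0 < ((t : ℂ) * b i).re := by
    intro t ht i
    simpa using mul_pos ht (hb i)
  -- inner integral in t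
  have hin : ∀ x : Fin (2 * p) → ℝ, ∫ t in Ioi (0 : ℝ), f t x =
      (∑ i, b i * ((x i : ℝ) : ℂ) ^ 2 + c) ^ (-α) * Complex.Gamma α := by
    intro x
    rw [← aux_gamma α hα0]
    · refine integral_congr_ae (Eventually.of_forall fun t => ?_)
      simp only [hf]
      rw [← Complex.exp_sum, mul_assoc, ← Complex.exp_add]
      congr 2
      rw [neg_mul, neg_mul, add_mul, Finset.sum_mul, neg_add, add_comm, ← Finset.sum_neg_distrib]
      congr 1
      refine Finset.sum_congr rfl fun i _ => ?_
      ring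
    · rw [Complex.add_re, Complex.re_sum]
      refine add_pos_of_nonneg_of_pos (Finset.sum_nonneg fun i _ => ?_) hc
      rw [← Complex.ofReal_pow, Complex.re_mul_ofReal]
      exact mul_nonneg (hb i).le (sq_nonneg _)
  -- inner integral in x
  have hout : ∀ t ∈ Ioi (0 : ℝ), ∫ x, f t x =
      (∏ i, (π / b i) ^ (1 / 2 : ℂ)) * ((t : ℂ) ^ (α - p - 1) * Complex.exp (-c * t)) := by
    intro t ht
    have ht : 0 < t := ht
    simp only [hf]
    rw [integral_const_mul, integral_fintype_prod_volume_eq_prod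
      (fun i (y : ℝ) => Complex.exp (-(t * b i) * (y : ℂ) ^ 2))]
    have : ∀ i, ∫ y : ℝ, Complex.exp (-(t * b i) * (y : ℂ) ^ 2) =
        (t : ℂ)⁻¹ ^ (1 / 2 : ℂ) * (π / b i) ^ (1 / 2 : ℂ) := by
      intro i
      rw [integral_gaussian_complex (hre t ht i)]
      rw [show (π : ℂ) / (t * b i) = ((t⁻¹ : ℝ) : ℂ) * (((π : ℝ) : ℂ) * (b i)⁻¹) by
        push_cast; rw [div_eq_mul_inv, mul_inv]; ring]
      have hbi : b i ≠ 0 := by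
        intro h
        have := hb i
        simp [h] at this
      rw [aux_rmul _ (inv_pos.2 ht) _ _
        (mul_ne_zero (by exact_mod_cast Real.pi_pos.ne') (inv_ne_zero hbi))]
      push_cast
      rw [div_eq_mul_inv (π : ℂ) (b i)]
    simp only [this]
    rw [Finset.prod_mul_distrib, Finset.prod_const, Finset.card_univ, Fintype.card_fin,
      aux_sqrt_pow t, show α - p - 1 = (α - 1) + -(p : ℂ) by ring,
      Complex.cpow_add _ _ (by exact_mod_cast ht.ne')]
    ring
  -- norm integral
  have hnorm : ∀ t ∈ Ioi (0 : ℝ), ∫ x, ‖f t x‖ =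
      (∏ i, √(π / (b i).re)) * (t ^ (α.re - p - 1) * Real.exp (-c.re * t)) := by
    intro t ht
    have ht : 0 < t := ht
    simp only [hf]
    simp_rw [norm_mul _ (∏ i, _), norm_prod]
    rw [integral_const_mul, integral_fintype_prod_volume_eq_prod
      (fun i (y : ℝ) => ‖Complex.exp (-(t * b i) * (y : ℂ) ^ 2)‖), aux_norm _ _ t ht]
    have : ∀ i, ∫ y : ℝ, ‖Complex.exp (-(t * b i) * (y : ℂ) ^ 2)‖ =
        √(t⁻¹) * √(π / (b i).re) := by
      intro i
      simp_rw [norm_cexp_neg_mul_sq]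
      rw [integral_gaussian, ← Real.sqrt_mul (inv_nonneg.2 ht.le)]
      congr 1
      rw [Complex.re_ofReal_mul, div_eq_mul_inv, mul_inv]; ring
    simp only [this]
    rw [Finset.prod_mul_distrib, Finset.prod_const, Finset.card_univ, Fintype.card_fin,
      pow_mul, Real.sq_sqrt (inv_nonneg.2 ht.le), show α.re - p - 1 = (α.re - 1) - (p : ℝ) by ring,
      Real.rpow_sub ht (α.re - 1), Real.rpow_natCast]
    rw [inv_pow]
    ring
  have hint : Integrable (Function.uncurry f)
      ((volume.restrict (Ioi (0 : ℝ))).prod (volume : Measure (Fin (2 * p) → ℝ))) := by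
    rw [integrable_prod_iff]
    · constructor
      · filter_upwards [ae_restrict_mem measurableSet_Ioi] with t ht
        have h0 := Integrable.fintype_prod
          (f := fun i (y : ℝ) => Complex.exp (-(t * b i) * (y : ℂ) ^ 2))
          (μ := fun _ => volume) fun i => integrable_cexp_neg_mul_sq (hre t ht i)
        exact h0.const_mul ((t : ℂ) ^ (α - 1) * Complex.exp (-c * t))
      · have h1 : IntegrableOn (fun t : ℝ => (∏ i, √(π / (b i).re)) *
            (t ^ (α.re - p - 1) * Real.exp (-c.re * t))) (Ioi 0) :=
          (aux_int (α.re - p - 1) (by linarith) c.re hc).const_mul _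
        refine Integrable.congr h1 ?_
        filter_upwards [ae_restrict_mem measurableSet_Ioi] with t ht
        exact (hnorm t ht).symm
    · refine Measurable.aestronglyMeasurable ?_
      simp only [hf, Function.uncurry_def]
      fun_prop
  have hswap := integral_integral_swap hint
  simp only [hin] at hswap
  rw [integral_mul_const] at hswap
  rw [← hswap, setIntegral_congr_fun measurableSet_Ioi hout, integral_const_mul,
    aux_gamma (α - p) (by simpa using hα) c hc, neg_sub]

lemma aux_theta (p : ℕ) (hp : 0 < p) (u : ℂ) (hu : 0 < u.im) (α : ℂ) (hα : (p : ℝ) < α.re)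
    (θ : ℝ) (h1 : -(π / 2) < θ) (h2 : θ < 0) :
    ∫ x : Fin (2 * p) → ℝ,
            (Complex.exp (2 * Complex.I * (θ : ℂ)) *
                ((x (⟨0, by omega⟩ : Fin (2 * p)) : ℝ) : ℂ) ^ 2 +
              (∑ i ∈ Finset.univ.erase (⟨0, by omega⟩ : Fin (2 * p)),
                ((x i : ℝ) : ℂ) ^ 2) - u) ^ (-α) =
    Complex.exp (-(θ * Complex.I)) *
      ((π : ℂ) ^ p * Complex.Gamma (α - (p : ℂ)) / Complex.Gamma α *
          (-u) ^ ((p : ℂ) - α)) := by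
  have hpi := Real.pi_pos
  have hα0 : 0 < α.re := lt_of_le_of_lt (by positivity) hα
  have hG : Complex.Gamma α ≠ 0 := Complex.Gamma_ne_zero_of_re_pos hα0
  have hu0 : -u ≠ 0 := by
    intro h
    have : u = 0 := by simpa using h
    simp [this] at hu
  have hua1 : -π < (-u).arg := Complex.neg_pi_lt_arg _
  have hua2 : (-u).arg < 0 := Complex.arg_neg_iff.2 (by simpa using hu)
  obtain ⟨φ, hφ0, hφ1, hφ2, hφ3⟩ : ∃ φ : ℝ, 0 < φ ∧ φ < π / 2 ∧ -(π / 2) < φ + 2 * θ ∧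
      -(π / 2) < φ + (-u).arg := by
    refine ⟨-(min (2 * θ) (-u).arg) / 2, ?_, ?_, ?_, ?_⟩ <;>
    rcases min_cases (2 * θ) (-u).arg with ⟨h, h'⟩ | ⟨h, h'⟩ <;> rw [h] <;> linarith
  set i0 : Fin (2 * p) := ⟨0, by omega⟩ with hi0
  set a : ℂ := Complex.exp (2 * Complex.I * (θ : ℂ)) with ha
  have ha' : a = Complex.exp (((2 * θ : ℝ) : ℂ) * Complex.I) := by
    rw [ha]; congr 1; push_cast; ring
  set w : ℂ := Complex.exp (φ * Complex.I) with hw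
  have ha0 : a ≠ 0 := Complex.exp_ne_zero _
  have hw0 : w ≠ 0 := Complex.exp_ne_zero _
  have haarg : a.arg = 2 * θ := by
    rw [ha', Complex.arg_exp_mul_I, toIocMod_eq_self]
    constructor <;> linarith
  have haim : a.im < 0 := Complex.arg_neg_iff.1 (by rw [haarg]; linarith)
  set b : Fin (2 * p) → ℂ := fun i => if i = i0 then w * a else w with hbdef
  have hwre : 0 < w.re := by
    have := aux_rot_re φ 1 one_ne_zero (by simp; linarith) (by simpa using hφ1)
    rwa [mul_one] at this
  have hb : ∀ i, 0 < (b i).re := by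
    intro i
    simp only [hbdef]
    split_ifs
    · exact aux_rot_re φ a ha0 (by rw [haarg]; linarith) (by rw [haarg]; linarith)
    · exact hwre
  have hc : 0 < (w * (-u)).re := aux_rot_re φ (-u) hu0 (by linarith) (by linarith)
  have key := aux_main p b hb _ hc α hα
  -- integrand
  have hI : ∀ x : Fin (2 * p) → ℝ, (∑ i, b i * ((x i : ℝ) : ℂ) ^ 2 + w * (-u)) ^ (-α) =
      Complex.exp (φ * Complex.I * (-α)) * (a * ((x i0 : ℝ) : ℂ) ^ 2 +
        (∑ i ∈ Finset.univ.erase i0, ((x i : ℝ) : ℂ) ^ 2) - u) ^ (-α) := by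
    intro x
    have him : (a * ((x i0 : ℝ) : ℂ) ^ 2 +
        (∑ i ∈ Finset.univ.erase i0, ((x i : ℝ) : ℂ) ^ 2) - u).im < 0 := by
      simp only [← Complex.ofReal_pow, ← Complex.ofReal_sum]
      simp only [Complex.sub_im, Complex.add_im, Complex.im_mul_ofReal, Complex.ofReal_im]
      nlinarith [sq_nonneg (x i0)]
    rw [← aux_cpow]
    · congr 1
      rw [← Finset.add_sum_erase _ _ (Finset.mem_univ i0)]
      have : ∑ i ∈ Finset.univ.erase i0, b i * ((x i : ℝ) : ℂ) ^ 2 =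
          w * ∑ i ∈ Finset.univ.erase i0, ((x i : ℝ) : ℂ) ^ 2 := by
        rw [Finset.mul_sum]
        refine Finset.sum_congr rfl fun i hi => ?_
        simp [hbdef, Finset.ne_of_mem_erase hi]
      rw [this]
      simp only [hbdef, if_true]
      ring
    · intro h; rw [h] at him; simp at him
    · have := Complex.neg_pi_lt_arg (a * ((x i0 : ℝ) : ℂ) ^ 2 +
        (∑ i ∈ Finset.univ.erase i0, ((x i : ℝ) : ℂ) ^ 2) - u)
      linarith
    · have := Complex.arg_neg_iff.2 him
      linarith
  simp only [hI] at key
  rw [integral_const_mul] at key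
  -- product
  have hwarg : ((π : ℂ) / w).arg = -φ := by
    rw [show (π : ℂ) / w = (π : ℝ) * Complex.exp (((-φ : ℝ) : ℂ) * Complex.I) by
      rw [hw, div_eq_mul_inv, ← Complex.exp_neg]; push_cast; ring_nf]
    rw [Complex.arg_real_mul _ hpi, Complex.arg_exp_mul_I, toIocMod_eq_self]
    constructor <;> linarith
  have hpw0 : (π : ℂ) / w ≠ 0 := div_ne_zero (by exact_mod_cast hpi.ne') hw0
  have hb0 : ((π : ℂ) / (w * a)) ^ (1 / 2 : ℂ) =
      Complex.exp (-(θ * Complex.I)) * ((π : ℂ) / w) ^ (1 / 2 : ℂ) := by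
    have := aux_cpow (-(2 * θ)) ((π : ℂ) / w) (1 / 2) hpw0 (by rw [hwarg]; linarith)
      (by rw [hwarg]; linarith)
    have e1 : Complex.exp (((-(2 * θ) : ℝ) : ℂ) * Complex.I) * (π / w) = π / (w * a) := by
      rw [ha', show ((-(2 * θ) : ℝ) : ℂ) * Complex.I = -(((2 * θ : ℝ) : ℂ) * Complex.I) by
        push_cast; ring, Complex.exp_neg, div_eq_mul_inv, div_eq_mul_inv, mul_inv]
      ring
    rw [e1] at this
    rw [this]
    congr 2
    push_cast; ring
  have hprod : ∏ i, ((π : ℂ) / b i) ^ (1 / 2 : ℂ) =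
      Complex.exp (-(θ * Complex.I)) * ((π : ℂ) / w) ^ p := by
    have hsq : (((π : ℂ) / w) ^ (1 / 2 : ℂ)) ^ 2 = (π : ℂ) / w := by
      rw [← Complex.cpow_nat_mul]; simp
    have hall : ∀ i, ((π : ℂ) / b i) ^ (1 / 2 : ℂ) =
        (if i = i0 then Complex.exp (-(θ * Complex.I)) else 1) * ((π : ℂ) / w) ^ (1 / 2 : ℂ) := by
      intro i
      simp only [hbdef]
      split_ifs
      · exact hb0
      · simp
    simp only [hall]
    rw [Finset.prod_mul_distrib, Finset.prod_const, Finset.card_univ, Fintype.card_fin, pow_mul,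
      hsq, Finset.prod_ite_eq']
    simp
  rw [hprod, aux_cpow φ (-u) _ hu0 (by linarith) (by linarith)] at key
  have hE : Complex.exp (φ * Complex.I * ((p : ℂ) - α)) =
      w ^ p * Complex.exp (φ * Complex.I * (-α)) := by
    rw [hw, ← Complex.exp_nat_mul, ← Complex.exp_add]
    congr 1; ring
  rw [hE] at key
  have hE0 : Complex.exp (φ * Complex.I * (-α)) ≠ 0 := Complex.exp_ne_zero _
  have hwp : w ^ p ≠ 0 := pow_ne_zero _ hw0
  rw [div_pow] at key
  apply mul_right_cancel₀ hG
  apply mul_left_cancel₀ hE0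
  rw [← mul_assoc, key]
  field_simp

/-- For `n = 2p` even, `Im u > 0` and `1 ≤ k ≤ p`: the
Minkowski-signature integral `∫_{ℝⁿ} (-x₁² + x₂² + ⋯ + xₙ² - u - i0)^{-α} dx` — the
boundary value, as `θ → -π/2⁺`, of the rotated integrals
`∫ (e^{2iθ}x₁² + Σ_{i≥2} xᵢ² - u)^{-α} dx` — equals, for `Re α > n/2`, `i` times the
Euclidean closed form `π^{n/2} Γ(α-n/2)(-u)^{n/2-α}/Γ(α)`, and the residue at `α = k` of
its meromorphic continuation equals `i π^{n/2} u^{n/2-k}/(Γ(k)(n/2-k)!)`, i.e. `i` times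
the Euclidean residue. -/
theorem stmt9 (p : ℕ) (hp : 0 < p) (u : ℂ) (hu : 0 < u.im)
    (k : ℕ) (hk1 : 1 ≤ k) (hkp : k ≤ p) :
    (∀ α : ℂ, (p : ℝ) < α.re →
      Tendsto (fun θ : ℝ =>
          ∫ x : Fin (2 * p) → ℝ,
            (Complex.exp (2 * Complex.I * (θ : ℂ)) *
                ((x (⟨0, by omega⟩ : Fin (2 * p)) : ℝ) : ℂ) ^ 2 +
              (∑ i ∈ Finset.univ.erase (⟨0, by omega⟩ : Fin (2 * p)),
                ((x i : ℝ) : ℂ) ^ 2) - u) ^ (-α))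
        (𝓝[>] (-(π / 2)))
        (𝓝 (Complex.I * ((π : ℂ) ^ p * Complex.Gamma (α - (p : ℂ)) / Complex.Gamma α *
          (-u) ^ ((p : ℂ) - α))))) ∧
    Tendsto (fun α : ℂ => (α - (k : ℂ)) *
        (Complex.I * ((π : ℂ) ^ p * Complex.Gamma (α - (p : ℂ)) / Complex.Gamma α *
          (-u) ^ ((p : ℂ) - α))))
      (𝓝[≠] (k : ℂ))
      (𝓝 (Complex.I * (π : ℂ) ^ p * u ^ (p - k) /
        (Complex.Gamma (k : ℂ) * ((p - k).factorial : ℂ)))) := by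
  refine ⟨fun α hα => ?_, aux_part2 p u hu k hk1 hkp⟩
  have hI : Complex.exp (-(((-(π / 2) : ℝ) : ℂ) * Complex.I)) = Complex.I := by
    rw [show -(((-(π / 2) : ℝ) : ℂ) * Complex.I) = (π : ℂ) / 2 * Complex.I by push_cast; ring]
    exact Complex.exp_pi_div_two_mul_I
  have hcont : Continuous (fun θ : ℝ => Complex.exp (-(θ * Complex.I)) *
      ((π : ℂ) ^ p * Complex.Gamma (α - (p : ℂ)) / Complex.Gamma α *
          (-u) ^ ((p : ℂ) - α))) := by fun_prop
  have ht := (hcont.tendsto (-(π / 2))).mono_left (nhdsWithin_le_nhds (s := Ioi (-(π / 2))))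
  rw [hI] at ht
  refine ht.congr' ?_
  have hlt : (-(π / 2)) < 0 := by linarith [Real.pi_pos]
  filter_upwards [Ioo_mem_nhdsGT hlt] with θ hθ
  exact (aux_theta p hp u hu α hα θ hθ.1 hθ.2).symm
end

section
/- (1-D weighted estimate for Feynman powers) Let m > 0, α ∈ ℂ with Re α > 0, ℓ ∈ [0, 1/2) with ℓ ≤ Re α, and s₁ > 1/2. Then the family of tempered distributions τ ↦ (−τ² + λ + m² − i0)^{−α}, λ ≥ 0, satisfies ‖(−τ² + λ + m² − i0)^{−α}‖_{H^{ℓ−Re α, −s₁}(ℝ)} = O(λ^{−Re α/2}) as λ → ∞, where H^{r,w}(ℝ) = ⟨t⟩^{−w} H^r(ℝ) is the weighted Sobolev space (Fourier weight r, spatial weight w). -/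
open Real MeasureTheory Set Filter Topology

/-- The Fourier transform `∫ e^{-2πi tξ} f(t) dt` on `ℝ`. -/
noncomputable def FT1 (f : ℝ → ℂ) (ξ : ℝ) : ℂ :=
  ∫ t : ℝ, Complex.exp (-(2 * (π : ℂ) * Complex.I) * ((t * ξ : ℝ) : ℂ)) * f t

/-- The weighted Sobolev norm `‖⟨D⟩^r ⟨t⟩^w ψ‖_{L²}` of `H^{r,w}(ℝ) = ⟨t⟩^{-w} H^r(ℝ)`. -/
noncomputable def wSobNorm (r w : ℝ) (ψ : ℝ → ℂ) : ℝ :=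
  (∫ ξ : ℝ, (1 + ξ ^ 2) ^ r *
      ‖FT1 (fun t : ℝ => (((1 + t ^ 2) ^ (w / 2) : ℝ) : ℂ) * ψ t) ξ‖ ^ 2) ^ (1 / 2 : ℝ)

/-- polynomial factors are dominated by exponentials -/
lemma aux_rpow_le_exp (N δ : ℝ) (hδ : 0 < δ) :
    ∃ C : ℝ, 0 ≤ C ∧ ∀ X : ℝ, 0 ≤ X → (1 + X) ^ N ≤ C * Real.exp (δ * X) := by
  have h1 : ∃ c : ℝ, 0 < c ∧ N ≤ c ∧ 1 ≤ c := ⟨max N 1, by positivity, le_max_left _ _, le_max_right _ _⟩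
  obtain ⟨c, hc0, hc1, hc2⟩ := h1
  -- (1+X) ≤ K exp (δ/c X)
  set K : ℝ := 1 + c / δ with hK
  have hKpos : 0 < K := by positivity
  have key : ∀ X : ℝ, 0 ≤ X → 1 + X ≤ K * Real.exp (δ / c * X) := by
    intro X hX
    have h := Real.add_one_le_exp (δ / c * X)
    have h2 : X = c / δ * (δ / c * X) := by field_simp
    have h3 : 0 ≤ δ / c * X := by positivity
    have h4 : 0 < c / δ := by positivity
    calc 1 + X = 1 + c / δ * (δ / c * X) := by rw [← h2]
      _ ≤ K * (δ / c * X + 1) := by rw [hK]; nlinarith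
      _ ≤ _ := by gcongr
  refine ⟨K ^ c, by positivity, fun X hX => ?_⟩
  calc (1 + X) ^ N ≤ (1 + X) ^ c := by
        apply Real.rpow_le_rpow_of_exponent_le <;> linarith
    _ ≤ (K * Real.exp (δ / c * X)) ^ c := by
        apply Real.rpow_le_rpow (by linarith) (key X hX) hc0.le
    _ = K ^ c * Real.exp (δ * X) := by
        rw [Real.mul_rpow hKpos.le (Real.exp_pos _).le, ← Real.exp_mul]
        congr 2; field_simp

/-- bound for complex powers -/
lemma aux_cpow_bd (γ : ℂ) (δ : ℝ) (hδ : 0 < δ) :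
    ∃ C : ℝ, 0 ≤ C ∧ ∀ (T X : ℝ) (q : ℂ), 0 < T → 0 ≤ X → T ≤ ‖q‖ → ‖q‖ ≤ T + X →
      ‖q ^ γ‖ ≤ C * (T ^ γ.re + (T + 1) ^ γ.re) * Real.exp (δ * X) := by
  obtain ⟨C, hC, h⟩ := aux_rpow_le_exp |γ.re| δ hδ
  refine ⟨Real.exp (π * |γ.im|) * (1 + C), by positivity, fun T X q hT hX h1 h2 => ?_⟩
  have hq : 0 < ‖q‖ := hT.trans_le h1
  have e1 : ‖q ^ γ‖ ≤ Real.exp (π * |γ.im|) * ‖q‖ ^ γ.re := by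
    refine (Complex.norm_cpow_le q γ).trans ?_
    rw [div_eq_mul_inv, ← Real.exp_neg, mul_comm]
    gcongr
    calc -(q.arg * γ.im) ≤ |q.arg * γ.im| := neg_le_abs _
      _ = |q.arg| * |γ.im| := abs_mul _ _
      _ ≤ _ := by gcongr; exact Complex.abs_arg_le_pi q
  have e2 : ‖q‖ ^ γ.re ≤ (T ^ γ.re + (T + 1) ^ γ.re) * ((1 + C) * Real.exp (δ * X)) := by
    have p1 : 0 < T ^ γ.re := by positivity
    have p2 : 0 < (T + 1) ^ γ.re := by positivity
    have p3 : 1 ≤ Real.exp (δ * X) := Real.one_le_exp (by positivity)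
    rcases le_total γ.re 0 with hg | hg
    · have : ‖q‖ ^ γ.re ≤ T ^ γ.re := Real.rpow_le_rpow_of_nonpos hT h1 hg
      have h5 : 1 ≤ (1 + C) * Real.exp (δ * X) := by nlinarith
      nlinarith
    · have h3 : ‖q‖ ^ γ.re ≤ (T + 1) ^ γ.re * (1 + X) ^ γ.re := by
        rw [← Real.mul_rpow (by positivity) (by positivity)]
        apply Real.rpow_le_rpow hq.le _ hg
        nlinarith
      have h4 := h X hX
      rw [abs_of_nonneg hg] at h4
      calc ‖q‖ ^ γ.re ≤ (T + 1) ^ γ.re * (1 + X) ^ γ.re := h3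
        _ ≤ (T + 1) ^ γ.re * (C * Real.exp (δ * X)) := by gcongr
        _ ≤ _ := by
          apply mul_le_mul (by linarith) _ (by positivity) (by positivity)
          nlinarith
  calc ‖q ^ γ‖ ≤ Real.exp (π * |γ.im|) * ‖q‖ ^ γ.re := e1
    _ ≤ Real.exp (π * |γ.im|) * ((T ^ γ.re + (T + 1) ^ γ.re) * ((1 + C) * Real.exp (δ * X))) := by
      gcongr
    _ = _ := by ring

/-- the integrand of the rotated Laplace integral -/
noncomputable def kern (α β : ℂ) (T : ℝ) (w ζ : ℂ) (y : ℝ) : ℂ :=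
  (y : ℂ) ^ (α - 1) * ((T : ℂ) + ζ * y) ^ β * Complex.exp (-(ζ * y * w))

lemma aux_norm_shift (T y : ℝ) (ζ : ℂ) (hT : 0 < T) (hy : 0 < y) (hζ : 0 ≤ ζ.re) :
    T ≤ ‖(T : ℂ) + ζ * y‖ ∧ ‖(T : ℂ) + ζ * y‖ ≤ T + ‖ζ‖ * y := by
  constructor
  · refine le_trans ?_ (Complex.re_le_norm _)
    simp
    positivity
  · refine (norm_add_le _ _).trans ?_
    simp [abs_of_pos hT, abs_of_pos hy]

lemma aux_shift_slit (T y : ℝ) (ζ : ℂ) (hT : 0 < T) (hy : 0 < y) (hζ : 0 ≤ ζ.re) :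
    (T : ℂ) + ζ * y ∈ Complex.slitPlane := by
  left
  simp
  positivity

lemma kern_bd (α β : ℂ) (δ : ℝ) (hδ : 0 < δ) :
    ∃ C : ℝ, 0 ≤ C ∧ ∀ (T : ℝ) (w ζ : ℂ) (y : ℝ), 0 < T → 0 < y → 0 ≤ ζ.re →
      ‖kern α β T w ζ y‖ ≤ C * (T ^ β.re + (T + 1) ^ β.re) *
        (y ^ (α.re - 1) * Real.exp (δ * (‖ζ‖ * y) - (ζ * w).re * y)) := by
  obtain ⟨C, hC, h⟩ := aux_cpow_bd β δ hδ
  refine ⟨C, hC, fun T w ζ y hT hy hζ => ?_⟩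
  obtain ⟨h1, h2⟩ := aux_norm_shift T y ζ hT hy hζ
  have h3 := h T (‖ζ‖ * y) _ hT (by positivity) h1 h2
  have h4 : ‖(y : ℂ) ^ (α - 1)‖ = y ^ (α.re - 1) := by
    rw [Complex.norm_cpow_eq_rpow_re_of_pos hy]; simp
  have h5 : ‖Complex.exp (-(ζ * y * w))‖ = Real.exp (- ((ζ * w).re * y)) := by
    rw [Complex.norm_exp]; congr 1; simp; ring
  rw [kern, norm_mul, norm_mul, h4, h5]
  calc _ ≤ y ^ (α.re - 1) * (C * (T ^ β.re + (T + 1) ^ β.re) * Real.exp (δ * (‖ζ‖ * y))) *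
        Real.exp (- ((ζ * w).re * y)) := by gcongr
    _ = _ := by rw [sub_eq_add_neg (δ * (‖ζ‖ * y)), Real.exp_add]; ring

lemma kern_meas (α β : ℂ) (T : ℝ) (w ζ : ℂ) : Measurable (kern α β T w ζ) := by
  unfold kern
  fun_prop

lemma aux_int_s17 (a k : ℝ) (ha : 0 < a) (hk : 0 < k) :
    IntegrableOn (fun y : ℝ => y ^ (a - 1) * Real.exp (-(k * y))) (Ioi 0) := by
  have := integrableOn_rpow_mul_exp_neg_mul_rpow (p := 1) (s := a - 1) (b := k) (by linarith)
    one_pos hk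
  simpa using this

lemma kern_int (α β : ℂ) (hα : 0 < α.re) (T : ℝ) (hT : 0 < T) (w ζ : ℂ) (hζ : 0 < ζ.re)
    (hw : 0 < (ζ * w).re) : IntegrableOn (kern α β T w ζ) (Ioi 0) := by
  have hz : 0 < ‖ζ‖ := hζ.trans_le (Complex.re_le_norm ζ)
  obtain ⟨C, hC, h⟩ := kern_bd α β ((ζ * w).re / 2 / ‖ζ‖) (by positivity)
  refine Integrable.mono' ((aux_int_s17 α.re ((ζ * w).re / 2) hα (by positivity)).const_mul
    (C * (T ^ β.re + (T + 1) ^ β.re))) (kern_meas _ _ _ _ _).aestronglyMeasurable ?_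
  refine (ae_restrict_iff' measurableSet_Ioi).2 (Eventually.of_forall fun y hy => ?_)
  refine (h T w ζ y hT hy hζ.le).trans_eq ?_
  congr 3
  field_simp
  ring

lemma kern_hasDeriv (α β : ℂ) (T : ℝ) (hT : 0 < T) (w ζ : ℂ) (hζ : 0 < ζ.re) (y : ℝ) (hy : 0 < y) :
    HasDerivAt (fun ζ => kern α β T w ζ y)
      (β * kern (α + 1) (β - 1) T w ζ y - w * kern (α + 1) β T w ζ y) ζ := by
  have hs := aux_shift_slit T y ζ hT hy hζ.le
  have h1 : HasDerivAt (fun ζ : ℂ => (T : ℂ) + ζ * y) (y : ℂ) ζ := by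
    simpa using ((hasDerivAt_id ζ).mul_const (y : ℂ)).const_add (T : ℂ)
  have h2 := h1.cpow_const (c := β) hs
  have h3 : HasDerivAt (fun ζ : ℂ => Complex.exp (-(ζ * y * w)))
      (Complex.exp (-(ζ * y * w)) * (-(y * w))) ζ := by
    apply HasDerivAt.cexp
    have h := (((hasDerivAt_id ζ).mul_const (y : ℂ)).mul_const w).neg
    rw [one_mul] at h
    exact h
  have h4 := (h2.const_mul ((y : ℂ) ^ (α - 1))).mul h3
  have hy' : (y : ℂ) ≠ 0 := by exact_mod_cast hy.ne'
  have h5 : (y : ℂ) ^ (α + 1 - 1) = (y : ℂ) ^ (α - 1) * y := by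
    rw [show α + 1 - 1 = (α - 1) + 1 by ring, Complex.cpow_add _ _ hy', Complex.cpow_one]
  unfold kern
  rw [h5]
  refine HasDerivAt.congr_deriv (h4) ?_
  ring

/-- the open sector of admissible rotations -/
def sect (w : ℂ) : Set ℂ := {ζ | 0 < ζ.re ∧ 0 < (ζ * w).re}

lemma sect_open (w : ℂ) : IsOpen (sect w) := by
  have e1 : Continuous fun z : ℂ => (z * w).re := by fun_prop
  exact (isOpen_lt continuous_const Complex.continuous_re).inter (isOpen_lt continuous_const e1)

lemma sect_convex (w : ℂ) : Convex ℝ (sect w) := by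
  intro x hx y hy a b ha hb hab
  obtain ⟨h1, h2⟩ := hx
  obtain ⟨h3, h4⟩ := hy
  have : 0 < a ∨ 0 < b := by
    by_contra! h
    linarith
  constructor
  · simp
    rcases this with h | h
    · have := mul_pos h h1
      have := mul_nonneg hb h3.le
      linarith
    · have := mul_nonneg ha h1.le
      have := mul_pos h h3
      linarith
  · have e : ((a • x + b • y) * w).re = a * (x * w).re + b * (y * w).re := by
      simp; ring
    rw [e]
    rcases this with h | h
    · have := mul_pos h h2
      have := mul_nonneg hb h4.le
      linarith
    · have := mul_nonneg ha h2.le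
      have := mul_pos h h4
      linarith

lemma kern_diff (α β : ℂ) (hα : 0 < α.re) (T : ℝ) (hT : 0 < T) (w : ℂ) :
    DifferentiableOn ℂ (fun ζ => ∫ y in Ioi (0 : ℝ), kern α β T w ζ y) (sect w) := by
  intro ζ hζ
  obtain ⟨h1, h2⟩ := hζ
  have hz : 0 < ‖ζ‖ := h1.trans_le (Complex.re_le_norm ζ)
  -- uniform lower bound k on Re (ζ w) and upper bound on the norm
  set k := (ζ * w).re / 2 with hk
  have hk0 : 0 < k := by positivity
  set R := ‖ζ‖ + 1 with hR
  have hR0 : 0 < R := by positivity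
  set s : Set ℂ := {z | 0 < z.re ∧ k < (z * w).re ∧ ‖z‖ < R} with hs
  have hso : IsOpen s := by
    have e1 : Continuous fun z : ℂ => (z * w).re := by fun_prop
    exact (isOpen_lt continuous_const Complex.continuous_re).inter
      ((isOpen_lt continuous_const e1).inter (isOpen_lt continuous_norm continuous_const))
  have hsz : ζ ∈ s := ⟨h1, by rw [hk]; linarith, by rw [hR]; linarith⟩
  obtain ⟨C1, hC1, b1⟩ := kern_bd (α + 1) (β - 1) (k / 2 / R) (by positivity)
  obtain ⟨C2, hC2, b2⟩ := kern_bd (α + 1) β (k / 2 / R) (by positivity)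
  set D := ‖β‖ * (C1 * (T ^ (β - 1).re + (T + 1) ^ (β - 1).re)) +
    ‖w‖ * (C2 * (T ^ β.re + (T + 1) ^ β.re)) with hD
  have := hasDerivAt_integral_of_dominated_loc_of_deriv_le (μ := volume.restrict (Ioi (0 : ℝ)))
    (F := fun ζ y => kern α β T w ζ y) (x₀ := ζ) (s := s)
    (F' := fun ζ y => β * kern (α + 1) (β - 1) T w ζ y - w * kern (α + 1) β T w ζ y)
    (bound := fun y => D * (y ^ ((α + 1).re - 1) * Real.exp (-(k / 2 * y))))
    (hso.mem_nhds hsz)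
    (Eventually.of_forall fun x => (kern_meas _ _ _ _ _).aestronglyMeasurable)
    (kern_int α β hα T hT w ζ h1 h2)
    (by
      apply Measurable.aestronglyMeasurable
      exact ((kern_meas _ _ _ _ _).const_mul _).sub ((kern_meas _ _ _ _ _).const_mul _))
    (by
      refine (ae_restrict_iff' measurableSet_Ioi).2 (Eventually.of_forall fun y hy z hz => ?_)
      obtain ⟨z1, z2, z3⟩ := hz
      have hy' : 0 < y := hy
      have e : Real.exp (k / 2 / R * (‖z‖ * y) - (z * w).re * y) ≤ Real.exp (-(k / 2 * y)) := by
        apply Real.exp_le_exp.2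
        have t1 : k / 2 / R * (‖z‖ * y) ≤ k / 2 * y := by
          calc k / 2 / R * (‖z‖ * y) ≤ k / 2 / R * (R * y) := by gcongr
            _ = _ := by field_simp
        have t2 : k * y ≤ (z * w).re * y := by gcongr
        linarith
      have c1 := b1 T w z y hT hy z1.le
      have c2 := b2 T w z y hT hy z1.le
      have p : 0 ≤ y ^ ((α + 1).re - 1) := by positivity
      calc _ ≤ ‖β‖ * ‖kern (α + 1) (β - 1) T w z y‖ + ‖w‖ * ‖kern (α + 1) β T w z y‖ := by
            refine (norm_sub_le _ _).trans ?_
            rw [norm_mul, norm_mul]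
        _ ≤ ‖β‖ * (C1 * (T ^ (β - 1).re + (T + 1) ^ (β - 1).re) * (y ^ ((α + 1).re - 1) * Real.exp (-(k / 2 * y)))) +
            ‖w‖ * (C2 * (T ^ β.re + (T + 1) ^ β.re) * (y ^ ((α + 1).re - 1) * Real.exp (-(k / 2 * y)))) := by
          gcongr
          · exact c1.trans (by gcongr)
          · exact c2.trans (by gcongr)
        _ = _ := by rw [hD]; ring)
    ((aux_int_s17 (α + 1).re (k / 2) (by simp; linarith) (by positivity)).const_mul _)
    (by
      refine (ae_restrict_iff' measurableSet_Ioi).2 (Eventually.of_forall fun y hy z hz => ?_)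
      exact kern_hasDeriv α β T hT w z hz.1 y hy)
  exact this.2.differentiableAt.differentiableWithinAt

lemma kern_rot (α β : ℂ) (hα : 0 < α.re) (T : ℝ) (hT : 0 < T) (w : ℂ) (hw : 0 < w.re) (ζ : ℂ)
    (h1 : 0 < ζ.re) (h2 : 0 < (ζ * w).re) :
    ζ ^ α * ∫ y in Ioi (0 : ℝ), kern α β T w ζ y = ∫ y in Ioi (0 : ℝ), kern α β T w 1 y := by
  have hd : DifferentiableOn ℂ (fun ζ : ℂ => ζ ^ α * ∫ y in Ioi (0 : ℝ), kern α β T w ζ y) (sect w) := by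
    apply DifferentiableOn.mul _ (kern_diff α β hα T hT w)
    intro z hz
    apply DifferentiableAt.differentiableWithinAt
    exact (differentiableAt_id).cpow_const (Or.inl hz.1)
  have ha := hd.analyticOnNhd (sect_open w)
  have h1m : (1 : ℂ) ∈ sect w := ⟨by simp, by simpa using hw⟩
  refine AnalyticOnNhd.eqOn_of_preconnected_of_frequently_eq (z₀ := 1) ha
    (analyticOnNhd_const (v := ∫ y in Ioi (0 : ℝ), kern α β T w 1 y))
    (sect_convex w).isPreconnected h1m ?_ (show ζ ∈ sect w from ⟨h1, h2⟩)
  -- real points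
  have hreal : ∀ b : ℝ, 0 < b → ((b : ℂ) ^ α * ∫ y in Ioi (0 : ℝ), kern α β T w b y)
      = ∫ y in Ioi (0 : ℝ), kern α β T w 1 y := by
    intro b hb
    have := integral_comp_mul_left_Ioi (kern α β T w 1) 0 hb
    rw [mul_zero] at this
    have e : ∫ y in Ioi (0 : ℝ), kern α β T w 1 (b * y) =
        (b : ℂ) ^ (α - 1) * ∫ y in Ioi (0 : ℝ), kern α β T w b y := by
      rw [← integral_const_mul]
      refine setIntegral_congr_fun measurableSet_Ioi fun y hy => ?_
      have hy' : 0 < y := hy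
      simp only [kern]
      push_cast
      rw [Complex.mul_cpow_ofReal_nonneg hb.le hy'.le]
      simp only [one_mul]
      ring
    rw [e] at this
    have hb' : (b : ℂ) ≠ 0 := by exact_mod_cast hb.ne'
    rw [Complex.real_smul, Complex.cpow_sub _ _ hb', Complex.cpow_one] at this
    push_cast at this
    field_simp at this
    exact this
  have ht : Tendsto (fun n : ℕ => ((1 + 1 / ((n : ℝ) + 1) : ℝ) : ℂ)) atTop (𝓝[≠] 1) := by
    apply tendsto_nhdsWithin_iff.2 ⟨_, _⟩
    · have : Tendsto (fun n : ℕ => (1 + 1 / ((n : ℝ) + 1) : ℝ)) atTop (𝓝 (1 + 0)) :=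
        tendsto_const_nhds.add tendsto_one_div_add_atTop_nhds_zero_nat
      have h := (Complex.continuous_ofReal.tendsto _).comp this
      simpa [Function.comp_def] using h
    · refine Eventually.of_forall fun n => ?_
      simp only [mem_compl_iff, mem_singleton_iff]
      have : (0 : ℝ) < 1 / ((n : ℝ) + 1) := by positivity
      intro h
      have h' : (1 + 1 / ((n : ℝ) + 1) : ℝ) = 1 := by exact_mod_cast h
      linarith
  refine ht.frequently (Frequently.of_forall fun n => ?_)
  exact hreal _ (by positivity)

lemma gamma_rot (α : ℂ) (hα : 0 < α.re) (r : ℂ) (hr : 0 < r.re) :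
    ∫ y in Ioi (0 : ℝ), (y : ℂ) ^ (α - 1) * Complex.exp (-(r * y)) = Complex.Gamma α * r ^ (-α) := by
  have h := kern_rot α 0 hα 1 one_pos 1 (by simp) r hr (by simpa using hr)
  have hr' : r ≠ 0 := by rintro rfl; simp at hr
  simp only [kern, Complex.cpow_zero, mul_one, one_mul] at h
  have h2 := Complex.integral_cpow_mul_exp_neg_mul_Ioi (r := 1) hα one_pos
  simp only [Complex.ofReal_one, one_mul, div_one, Complex.one_cpow] at h2
  rw [h2] at h
  rw [← h, Complex.cpow_neg]
  have : r ^ α ≠ 0 := by simp [Complex.cpow_eq_zero_iff, hr']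
  field_simp
/-- factorization of the complex power -/
lemma aux_factor (α μ : ℂ) (h1 : 0 < μ.re) (h2 : μ.im < 0) (τ : ℝ) :
    (μ ^ 2 - (τ : ℂ) ^ 2) ^ (-α) = Complex.exp (α * (Real.log (4 * π ^ 2) + π * Complex.I)) *
      ((2 * π * Complex.I * (μ - τ)) ^ (-α) * (2 * π * Complex.I * (μ + τ)) ^ (-α)) := by
  set z := μ ^ 2 - (τ : ℂ) ^ 2 with hz
  set r₁ := 2 * π * Complex.I * (μ - τ) with hr1
  set r₂ := 2 * π * Complex.I * (μ + τ) with hr2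
  have zim : z.im < 0 := by
    have : z.im = 2 * (μ.re * μ.im) := by
      rw [hz]; simp [pow_two]; ring
    rw [this]
    have := mul_neg_of_pos_of_neg h1 h2
    linarith
  have r1 : 0 < r₁.re := by
    have : r₁.re = 2 * π * (-μ.im) := by rw [hr1]; simp
    rw [this]; have := Real.pi_pos; apply mul_pos <;> linarith
  have r2 : 0 < r₂.re := by
    have : r₂.re = 2 * π * (-μ.im) := by rw [hr2]; simp
    rw [this]; have := Real.pi_pos; apply mul_pos <;> linarith
  have n0 : z ≠ 0 := by intro h; rw [h] at zim; simp at zim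
  have n1 : r₁ ≠ 0 := by intro h; rw [h] at r1; simp at r1
  have n2 : r₂ ≠ 0 := by intro h; rw [h] at r2; simp at r2
  have a1 := abs_lt.1 ((Complex.abs_arg_lt_pi_div_two_iff).2 (Or.inl r1))
  have a2 := abs_lt.1 ((Complex.abs_arg_lt_pi_div_two_iff).2 (Or.inl r2))
  have hl := Complex.log_mul n1 n2 ⟨by linarith [a1.1, a2.1], by linarith [a1.2, a2.2]⟩
  have hp : r₁ * r₂ = ((4 * π ^ 2 : ℝ) : ℂ) * (-z) := by
    have hI : Complex.I ^ 2 = -1 := Complex.I_sq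
    rw [hr1, hr2, hz]; push_cast; linear_combination (4 * π ^ 2 * (μ ^ 2 - τ ^ 2)) * hI
  rw [hp, Complex.log_ofReal_mul (by positivity) (neg_ne_zero.2 n0)] at hl
  have hneg : Complex.log (-z) = Complex.log z + π * Complex.I := by
    rw [Complex.log, Complex.log, norm_neg, Complex.arg_neg_eq_arg_add_pi_of_im_neg zim]
    push_cast; ring
  rw [hneg] at hl
  rw [Complex.cpow_def_of_ne_zero n0, Complex.cpow_def_of_ne_zero n1,
    Complex.cpow_def_of_ne_zero n2, ← Complex.exp_add, ← Complex.exp_add]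
  congr 1
  linear_combination (-α) * hl

/-- the character -/
noncomputable def ch (x : ℝ) : ℂ := Complex.exp (2 * π * Complex.I * x)

lemma ch_norm (x : ℝ) : ‖ch x‖ = 1 := by
  unfold ch; rw [Complex.norm_exp]; simp

lemma ch_meas : Measurable ch := by unfold ch; fun_prop

lemma ch_add (x y : ℝ) : ch (x + y) = ch x * ch y := by
  unfold ch; rw [← Complex.exp_add]; congr 1; push_cast; ring

lemma FT1_eq (f : ℝ → ℂ) (ξ : ℝ) : FT1 f ξ = ∫ t : ℝ, ch (-(t * ξ)) * f t := by
  unfold FT1 ch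
  congr 1; ext t; congr 2; push_cast; ring

lemma FT1_fourier (ψ : SchwartzMap ℝ ℂ) : FT1 (fun t => ψ t) = FourierTransform.fourier ψ := by
  ext ξ
  rw [SchwartzMap.fourier_coe, Real.fourier_eq', FT1]
  congr 1; ext t
  rw [smul_eq_mul]
  congr 2
  simp
  ring

lemma aux_autocorr (f : ℝ → ℂ) (hf : Integrable f) (ψ : SchwartzMap ℝ ℂ) :
    ∫ τ : ℝ, ((∫ p : ℝ, f p * ch (p * τ)) * (∫ q : ℝ, f q * ch (-(q * τ)))) * ψ τ
      = ∫ t : ℝ, (∫ p : ℝ, f p * f (p + t)) * FT1 (fun t => ψ t) t := by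
  have hψ : Integrable (fun t => ψ t) := ψ.integrable
  set P := FT1 (fun t => ψ t) with hP
  have hPc : Continuous P := by
    rw [hP, FT1_fourier]; exact (FourierTransform.fourier ψ).continuous
  have hPb : ∀ t, ‖P t‖ ≤ ∫ τ, ‖ψ τ‖ := by
    intro t
    rw [hP, FT1_eq]
    refine (norm_integral_le_integral_norm _).trans_eq ?_
    congr 1; ext τ; rw [norm_mul, ch_norm, one_mul]
  have hff : Integrable (fun z : ℝ × ℝ => f z.1 * f z.2) (volume.prod volume) := hf.mul_prod hf
  have step1 : ∀ τ, ((∫ p : ℝ, f p * ch (p * τ)) * (∫ q : ℝ, f q * ch (-(q * τ)))) * ψ τ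
      = ∫ z : ℝ × ℝ, (f z.1 * f z.2) * (ch (-(τ * (z.2 - z.1))) * ψ τ) := by
    intro τ
    rw [← integral_prod_mul, ← integral_mul_const]
    refine integral_congr_ae (Eventually.of_forall fun z => ?_)
    have : ch (-(τ * (z.2 - z.1))) = ch (z.1 * τ) * ch (-(z.2 * τ)) := by
      rw [← ch_add]; congr 1; ring
    simp only [this]; ring
  simp_rw [step1]
  rw [integral_integral_swap]
  · have step2 : ∀ z : ℝ × ℝ, ∫ τ, (f z.1 * f z.2) * (ch (-(τ * (z.2 - z.1))) * ψ τ)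
        = (f z.1 * f z.2) * P (z.2 - z.1) := by
      intro z
      rw [integral_const_mul, hP, FT1_eq]
    simp_rw [step2]
    have hintg : Integrable (fun z : ℝ × ℝ => (f z.1 * f z.2) * P (z.2 - z.1))
        (volume.prod volume) := by
      refine hff.mul_bdd (c := ∫ τ, ‖ψ τ‖) ?_ (Eventually.of_forall fun z => hPb _)
      exact (hPc.comp (by fun_prop)).aestronglyMeasurable
    have mp := measurePreserving_prod_add (volume : Measure ℝ) (volume : Measure ℝ)
    have hint2 : Integrable (fun z : ℝ × ℝ => (f z.1 * f (z.1 + z.2)) * P z.2)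
        (volume.prod volume) := by
      have := mp.integrable_comp_of_integrable hintg
      refine this.congr (Eventually.of_forall fun z => ?_)
      simp
    change ∫ z : ℝ × ℝ, _ ∂(volume.prod volume) = _
    rw [integral_prod _ hintg]
    have step3 : ∀ p : ℝ, ∫ q : ℝ, f p * f q * P (q - p) = ∫ t : ℝ, f p * f (p + t) * P t := by
      intro p
      rw [← integral_add_left_eq_self (fun q : ℝ => f p * f q * P (q - p)) p]
      congr 1; ext t; simp
    simp_rw [step3]
    rw [integral_integral_swap]
    · congr 1; ext t
      rw [integral_mul_const]
    · exact hint2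
  · have h := (hψ.mul_prod hff)
    refine (h.bdd_mul (c := 1) (f := fun z : ℝ × ℝ × ℝ => ch (-(z.1 * (z.2.2 - z.2.1)))) ?_ ?_).congr ?_
    · exact (ch_meas.comp (by fun_prop)).aestronglyMeasurable
    · exact Eventually.of_forall fun z => (ch_norm _).le
    · refine Eventually.of_forall fun z => ?_
      simp only [Function.uncurry]; ring

/-- the one-sided kernel -/
noncomputable def fk (α μ : ℂ) : ℝ → ℂ :=
  indicator (Ioi 0) fun p : ℝ => (p : ℂ) ^ (α - 1) * Complex.exp (-(2 * π * Complex.I * μ * p))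

lemma aux_exp_norm (μ : ℂ) (p : ℝ) :
    ‖Complex.exp (-(2 * π * Complex.I * μ * p))‖ = Real.exp (-((-(2 * π * μ.im)) * p)) := by
  rw [Complex.norm_exp]; congr 1; simp

lemma fk_int (α μ : ℂ) (hα : 0 < α.re) (h2 : μ.im < 0) : Integrable (fk α μ) := by
  unfold fk
  rw [integrable_indicator_iff measurableSet_Ioi]
  have hk : 0 < -(2 * π * μ.im) := by have := Real.pi_pos; nlinarith
  refine Integrable.mono' (aux_int_s17 α.re _ hα hk) ?_ ?_
  · apply Measurable.aestronglyMeasurable; fun_prop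
  · refine (ae_restrict_iff' measurableSet_Ioi).2 (Eventually.of_forall fun y hy => ?_)
    rw [norm_mul, Complex.norm_cpow_eq_rpow_re_of_pos hy, aux_exp_norm]
    simp

lemma fk_char (α μ : ℂ) (hα : 0 < α.re) (h2 : μ.im < 0) (σ : ℝ) :
    ∫ p : ℝ, fk α μ p * ch (p * σ) =
      Complex.Gamma α * (2 * π * Complex.I * (μ - σ)) ^ (-α) := by
  rw [← gamma_rot α hα]
  · rw [← integral_indicator measurableSet_Ioi]
    congr 1; ext p
    unfold fk
    by_cases hp : p ∈ Ioi (0 : ℝ)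
    · rw [indicator_of_mem hp, indicator_of_mem hp, mul_assoc, ch, ← Complex.exp_add]
      congr 2; push_cast; ring
    · rw [indicator_of_notMem hp, indicator_of_notMem hp, zero_mul]
  · have : (2 * π * Complex.I * (μ - σ)).re = 2 * π * (-μ.im) := by simp
    rw [this]; have := Real.pi_pos; apply mul_pos <;> linarith

/-- the Fourier-side kernel -/
noncomputable def Vk (α μ : ℂ) (t : ℝ) : ℂ :=
  Complex.exp (-(2 * π * Complex.I * μ * (|t| : ℝ))) * ((1 - Complex.I) ^ α *
    ∫ y in Ioi (0 : ℝ), kern α (α - 1) |t| (4 * π * Complex.I * μ) (1 - Complex.I) y)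

lemma aux_wre (μ : ℂ) : ((1 - Complex.I) * (4 * π * Complex.I * μ)).re = 4 * π * (μ.re - μ.im) := by
  simp; ring

lemma fk_auto_pos (α μ : ℂ) (hα : 0 < α.re) (h1 : 0 < μ.re) (h2 : μ.im < 0) (t : ℝ) (ht : 0 < t) :
    ∫ p : ℝ, fk α μ p * fk α μ (p + t) = Vk α μ t := by
  have hpi := Real.pi_pos
  rw [Vk, kern_rot α (α - 1) hα |t| (abs_pos.2 ht.ne') _ _ _ (by simp)]
  · rw [← integral_const_mul, ← integral_indicator measurableSet_Ioi]
    congr 1; ext p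
    unfold fk
    by_cases hp : p ∈ Ioi (0 : ℝ)
    · have hpt : p + t ∈ Ioi (0 : ℝ) := by
        have : 0 < p := hp
        show 0 < p + t
        linarith
      rw [indicator_of_mem hp, indicator_of_mem hp, indicator_of_mem hpt, abs_of_pos ht, kern]
      have : Complex.exp (-(2 * π * Complex.I * μ * p)) * Complex.exp (-(2 * π * Complex.I * μ * ((p + t : ℝ) : ℂ)))
        = Complex.exp (-(2 * π * Complex.I * μ * t)) * Complex.exp (-(1 * p * (4 * π * Complex.I * μ))) := by
        rw [← Complex.exp_add, ← Complex.exp_add]; congr 1; push_cast; ring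
      rw [show (t : ℂ) + 1 * p = ((p + t : ℝ) : ℂ) by push_cast; ring]
      linear_combination ((p : ℂ) ^ (α - 1) * ((p + t : ℝ) : ℂ) ^ (α - 1)) * this
    · rw [indicator_of_notMem hp, indicator_of_notMem hp, zero_mul]
  · rw [aux_wre]; apply mul_pos <;> linarith
  · have : (4 * π * Complex.I * μ).re = 4 * π * (-μ.im) := by simp
    rw [this]; apply mul_pos <;> linarith

lemma fk_auto (α μ : ℂ) (hα : 0 < α.re) (h1 : 0 < μ.re) (h2 : μ.im < 0) (t : ℝ) (ht : t ≠ 0) :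
    ∫ p : ℝ, fk α μ p * fk α μ (p + t) = Vk α μ t := by
  rcases lt_or_gt_of_ne ht with h | h
  · have e := fk_auto_pos α μ hα h1 h2 (-t) (by linarith)
    have e2 : Vk α μ (-t) = Vk α μ t := by unfold Vk; rw [abs_neg]
    rw [e2] at e
    rw [← e, ← integral_add_right_eq_self (fun p => fk α μ p * fk α μ (p + t)) (-t)]
    congr 1; ext p
    rw [neg_add_cancel_right, mul_comm]
  · exact fk_auto_pos α μ hα h1 h2 t h

noncomputable def cst (α : ℂ) : ℂ :=
  Complex.exp (α * (Real.log (4 * π ^ 2) + π * Complex.I)) / Complex.Gamma α ^ 2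

lemma main_repr (α μ : ℂ) (hα : 0 < α.re) (h1 : 0 < μ.re) (h2 : μ.im < 0) (ψ : SchwartzMap ℝ ℂ) :
    ∫ τ : ℝ, (μ ^ 2 - (τ : ℂ) ^ 2) ^ (-α) * ψ τ
      = cst α * ∫ t : ℝ, Vk α μ t * FT1 (fun t => ψ t) t := by
  have hG : Complex.Gamma α ≠ 0 := Complex.Gamma_ne_zero_of_re_pos hα
  have e : ∀ τ : ℝ, (μ ^ 2 - (τ : ℂ) ^ 2) ^ (-α) * ψ τ = cst α *
      (((∫ p : ℝ, fk α μ p * ch (p * τ)) * (∫ q : ℝ, fk α μ q * ch (-(q * τ)))) * ψ τ) := by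
    intro τ
    have : ∀ q : ℝ, -(q * τ) = q * (-τ) := fun q => by ring
    simp_rw [this]
    rw [fk_char α μ hα h2, fk_char α μ hα h2, aux_factor α μ h1 h2, cst]
    push_cast
    rw [sub_neg_eq_add]
    field_simp
  simp_rw [e]
  rw [integral_const_mul, aux_autocorr _ (fk_int α μ hα h2)]
  congr 1
  apply integral_congr_ae
  have : ∀ᵐ t : ℝ, t ≠ 0 := by
    simp [ae_iff, measure_singleton]
  filter_upwards [this] with t ht
  rw [fk_auto α μ hα h1 h2 t ht]

lemma Vk_kern_bd (α : ℂ) : ∃ C : ℝ, 0 ≤ C ∧ ∀ (lam : ℝ) (μ : ℂ) (T y : ℝ), 1 ≤ lam →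
    √lam ≤ μ.re → μ.im ≤ 0 → 0 < T → 0 < y →
    ‖kern α (α - 1) T (4 * π * Complex.I * μ) (1 - Complex.I) y‖ ≤
      C * (T ^ (α.re - 1) + (T + 1) ^ (α.re - 1)) * (y ^ (α.re - 1) * Real.exp (-(√lam * y))) := by
  obtain ⟨C, hC, h⟩ := kern_bd α (α - 1) (1 / 2) (by norm_num)
  refine ⟨C, hC, fun lam μ T y hl h1 h2 hT hy => ?_⟩
  refine (h T _ _ y hT hy (by simp)).trans ?_
  rw [aux_wre]
  have hz : ‖(1 : ℂ) - Complex.I‖ ≤ 2 := by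
    refine (norm_sub_le _ _).trans ?_; simp; norm_num
  have hs : 1 ≤ √lam := Real.one_le_sqrt.2 hl
  have hpi := Real.pi_gt_three
  simp only [Complex.sub_re, Complex.one_re]
  gcongr
  have e1 : 1 / 2 * (‖(1 : ℂ) - Complex.I‖ * y) ≤ y := by nlinarith
  have e2 : 2 * √lam ≤ 4 * π * (μ.re - μ.im) := by nlinarith
  nlinarith

lemma Vk_bd (α : ℂ) (hα : 0 < α.re) : ∃ C : ℝ, 0 ≤ C ∧ ∀ (lam : ℝ) (μ : ℂ) (t : ℝ), 1 ≤ lam →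
    √lam ≤ μ.re → μ.im ≤ 0 → t ≠ 0 →
    ‖Vk α μ t‖ ≤ C * lam ^ (-α.re / 2) * (|t| ^ (α.re - 1) + (|t| + 1) ^ (α.re - 1)) := by
  obtain ⟨C, hC, h⟩ := Vk_kern_bd α
  refine ⟨‖(1 - Complex.I) ^ α‖ * (C * Real.Gamma α.re), by
    have := Real.Gamma_pos_of_pos hα; positivity, fun lam μ t hl h1 h2 ht => ?_⟩
  have hs : 0 < √lam := by positivity
  have hpi := Real.pi_pos
  have hI : ‖∫ y in Ioi (0 : ℝ), kern α (α - 1) |t| (4 * π * Complex.I * μ) (1 - Complex.I) y‖ ≤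
      C * (|t| ^ (α.re - 1) + (|t| + 1) ^ (α.re - 1)) * (lam ^ (-α.re / 2) * Real.Gamma α.re) := by
    refine (norm_integral_le_of_norm_le ((aux_int_s17 α.re (√lam) hα hs).const_mul _)
      ((ae_restrict_iff' measurableSet_Ioi).2 (Eventually.of_forall fun y hy =>
        h lam μ |t| y hl h1 h2 (abs_pos.2 ht) hy))).trans_eq ?_
    rw [integral_const_mul, Real.integral_rpow_mul_exp_neg_mul_Ioi hα hs]
    congr 2
    rw [one_div, Real.inv_rpow hs.le, Real.sqrt_eq_rpow, ← Real.rpow_mul (by linarith),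
      ← Real.rpow_neg (by linarith)]
    congr 1; ring
  have hE : ‖Complex.exp (-(2 * π * Complex.I * μ * (|t| : ℝ)))‖ ≤ 1 := by
    rw [aux_exp_norm, Real.exp_le_one_iff]
    have := mul_nonneg hpi.le (mul_nonneg (neg_nonneg.2 h2) (abs_nonneg t))
    linarith
  rw [Vk, norm_mul, norm_mul]
  calc _ ≤ 1 * (‖(1 - Complex.I) ^ α‖ * (C * (|t| ^ (α.re - 1) + (|t| + 1) ^ (α.re - 1)) *
        (lam ^ (-α.re / 2) * Real.Gamma α.re))) := by gcongr
    _ = _ := by ring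

lemma Vk_tendsto (α : ℂ) (hα : 0 < α.re) (lam : ℝ) (hl : 1 ≤ lam) (μ : ℝ → ℂ) (μ₀ : ℂ)
    (l : Filter ℝ) [l.IsCountablyGenerated]
    (hμ : Tendsto μ l (𝓝 μ₀)) (h1 : ∀ᶠ ε in l, √lam ≤ (μ ε).re) (h2 : ∀ᶠ ε in l, (μ ε).im ≤ 0)
    (t : ℝ) (ht : t ≠ 0) : Tendsto (fun ε => Vk α (μ ε) t) l (𝓝 (Vk α μ₀ t)) := by
  obtain ⟨C, hC, h⟩ := Vk_kern_bd α
  have hs : 0 < √lam := by positivity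
  unfold Vk
  apply Tendsto.mul
  · refine (Complex.continuous_exp.tendsto _).comp ?_
    exact ((hμ.const_mul _).mul_const _).neg
  apply Tendsto.const_mul
  refine tendsto_integral_filter_of_dominated_convergence
    (fun y => C * (|t| ^ (α.re - 1) + (|t| + 1) ^ (α.re - 1)) * (y ^ (α.re - 1) * Real.exp (-(√lam * y))))
    (Eventually.of_forall fun ε => (kern_meas _ _ _ _ _).aestronglyMeasurable) ?_
    ((aux_int_s17 α.re (√lam) hα hs).const_mul _) ?_
  · filter_upwards [h1, h2] with ε g1 g2
    exact (ae_restrict_iff' measurableSet_Ioi).2 (Eventually.of_forall fun y hy =>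
        h lam (μ ε) |t| y hl g1 g2 (abs_pos.2 ht) hy)
  · refine Eventually.of_forall fun y => ?_
    unfold kern
    apply Tendsto.const_mul
    refine (Complex.continuous_exp.tendsto _).comp ?_
    exact ((hμ.const_mul _).const_mul _).neg
/-- The multiplied Schwartz function `⟨t⟩^s ψ`. -/
lemma exists_phi (s : ℝ) (ψ : SchwartzMap ℝ ℂ) : ∃ φ : SchwartzMap ℝ ℂ,
    ∀ t, φ t = (((1 + t ^ 2) ^ (s / 2) : ℝ) : ℂ) * ψ t := by
  have hg : (fun x : ℝ => (1 + x ^ 2) ^ (s / 2)).HasTemperateGrowth := by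
    simpa using Function.hasTemperateGrowth_one_add_norm_sq_rpow ℝ (s / 2)
  refine ⟨SchwartzMap.smulLeftCLM (𝕜 := ℝ) ℂ (fun x : ℝ => (1 + x ^ 2) ^ (s / 2)) ψ, fun t => ?_⟩
  rw [SchwartzMap.smulLeftCLM_apply_apply hg, Complex.real_smul]

lemma schwartz_weight_int (s : ℝ) (ψ : SchwartzMap ℝ ℂ) :
    Integrable (fun t : ℝ => (1 + t ^ 2) ^ s * ‖ψ t‖) := by
  obtain ⟨φ, hφ⟩ := exists_phi (2 * s) ψ
  refine φ.integrable.norm.congr (Eventually.of_forall fun t => ?_)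
  have : 0 ≤ (1 + t ^ 2) ^ s := by positivity
  simp only [hφ, norm_mul, Complex.norm_real, Real.norm_eq_abs]
  rw [show 2 * s / 2 = s by ring, abs_of_nonneg this]

lemma schwartz_weight_sq_int (s : ℝ) (ψ : SchwartzMap ℝ ℂ) :
    Integrable (fun t : ℝ => (1 + t ^ 2) ^ s * ‖ψ t‖ ^ 2) := by
  obtain ⟨φ, hφ⟩ := exists_phi s ψ
  have h := (φ.memLp 2).integrable_norm_pow (by norm_num)
  refine h.congr (Eventually.of_forall fun t => ?_)
  have h0 : (0 : ℝ) < 1 + t ^ 2 := by positivity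
  have : 0 ≤ (1 + t ^ 2) ^ (s / 2) := by positivity
  simp only [hφ, norm_mul, Complex.norm_real, Real.norm_eq_abs]
  rw [abs_of_nonneg this, mul_pow, ← Real.rpow_natCast, ← Real.rpow_mul h0.le]
  norm_num

lemma japanese_int (b : ℝ) (hb : 1 / 2 < b) : Integrable (fun t : ℝ => (1 + t ^ 2) ^ (-b)) := by
  have := integrable_rpow_neg_one_add_norm_sq (E := ℝ) (μ := volume) (r := 2 * b)
    (by simp; linarith)
  refine this.congr (Eventually.of_forall fun t => ?_)
  simp only [Real.norm_eq_abs, sq_abs]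
  congr 1; ring

/-- Cauchy–Schwarz -/
lemma cs_ineq (f g : ℝ → ℝ) (hf : ∀ x, 0 ≤ f x) (hg : ∀ x, 0 ≤ g x) (mf : Measurable f)
    (mg : Measurable g) :
    ∫⁻ x, ENNReal.ofReal (f x) * ENNReal.ofReal (g x) ≤
      (∫⁻ x, ENNReal.ofReal (f x ^ 2)) ^ (1 / 2 : ℝ) * (∫⁻ x, ENNReal.ofReal (g x ^ 2)) ^ (1 / 2 : ℝ) := by
  have := ENNReal.lintegral_mul_le_Lp_mul_Lq (volume : Measure ℝ) Real.HolderConjugate.two_two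
    (f := fun x => ENNReal.ofReal (f x)) (g := fun x => ENNReal.ofReal (g x))
    mf.ennreal_ofReal.aemeasurable mg.ennreal_ofReal.aemeasurable
  refine this.trans_eq ?_
  congr 3 <;> ext x
  · rw [ENNReal.ofReal_rpow_of_nonneg (hf x) (by norm_num)]; norm_num
  · rw [ENNReal.ofReal_rpow_of_nonneg (hg x) (by norm_num)]; norm_num

lemma aux_peetre (r t ξ : ℝ) (hr : 0 ≤ r) :
    (1 + t ^ 2) ^ (r / 2) ≤ 2 ^ (r / 2) * (1 + ξ ^ 2) ^ (r / 2) * (1 + (t - ξ) ^ 2) ^ (r / 2) := by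
  rw [← Real.mul_rpow (by positivity) (by positivity), ← Real.mul_rpow (by positivity) (by positivity)]
  apply Real.rpow_le_rpow (by positivity) _ (by positivity)
  nlinarith [sq_nonneg (t - ξ - ξ), sq_nonneg (ξ * (t - ξ)), sq_nonneg ((t-ξ) + ξ)]

/-- abstract multiplier estimate -/
lemma mult_est {Ω : Type} [MeasurableSpace Ω] (ρ : Measure Ω) [SFinite ρ] (κ Ξ : Ω → ℝ)
    (hκ : ∀ ω, 0 ≤ κ ω) (mκ : Measurable κ) (mΞ : Measurable Ξ) (r s c₀ ℓ : ℝ) (hr : 0 ≤ r)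
    (hc : 0 < c₀) (hℓ : ℓ < 1 / 2)
    (hintg : Integrable (fun ω => κ ω * (1 + Ξ ω ^ 2) ^ (r / 2)) ρ)
    (hM : ∀ τ : ℝ, ∫ ω, (κ ω : ℂ) * ch (Ξ ω * τ) ∂ρ = ((c₀ * (1 + τ ^ 2) ^ (-(s / 2)) : ℝ) : ℂ)) :
    ∃ C : ℝ, 0 ≤ C ∧ ∀ ψ φ : SchwartzMap ℝ ℂ, (∀ t, φ t = (((1 + t ^ 2) ^ (s / 2) : ℝ) : ℂ) * ψ t) →
      ∫ t : ℝ, (1 + t ^ 2) ^ ((r + ℓ - 1) / 2) * ‖FT1 (fun t => ψ t) t‖ ≤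
        C * (∫ ξ : ℝ, (1 + ξ ^ 2) ^ r * ‖FT1 (fun t => φ t) ξ‖ ^ 2) ^ (1 / 2 : ℝ) := by
  have hκint : Integrable κ ρ := by
    refine hintg.mono' mκ.aestronglyMeasurable (Eventually.of_forall fun ω => ?_)
    rw [Real.norm_eq_abs, abs_of_nonneg (hκ ω)]
    have : 1 ≤ (1 + Ξ ω ^ 2) ^ (r / 2) := Real.one_le_rpow (by nlinarith [sq_nonneg (Ξ ω)]) (by positivity)
    nlinarith [hκ ω]
  set A : ℝ → ℝ := fun t => (1 + t ^ 2) ^ ((ℓ - 1) / 2) with hA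
  have hA0 : ∀ t, 0 ≤ A t := fun t => by simp only [hA]; positivity
  have mA : Measurable A := by simp only [hA]; fun_prop
  set K := ∫ ω, κ ω * (1 + Ξ ω ^ 2) ^ (r / 2) ∂ρ with hK
  have hK0 : 0 ≤ K := integral_nonneg fun ω => mul_nonneg (hκ ω) (by positivity)
  set A2 := ∫ t, A t ^ 2 with hA2
  have hAint : Integrable (fun t => A t ^ 2) := by
    refine (japanese_int (1 - ℓ) (by linarith)).congr (Eventually.of_forall fun t => ?_)
    have h0 : (0 : ℝ) < 1 + t ^ 2 := by positivity
    simp only [hA]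
    rw [← Real.rpow_natCast ((1 + t ^ 2) ^ ((ℓ - 1) / 2)) 2, ← Real.rpow_mul h0.le]
    congr 1; push_cast; ring
  have hA20 : 0 ≤ A2 := integral_nonneg fun t => by positivity
  refine ⟨c₀⁻¹ * (2 ^ (r / 2) * K * A2 ^ (1 / 2 : ℝ)), by positivity, fun ψ φ hφ => ?_⟩
  set P := FT1 (fun t => ψ t) with hP
  set Φ := FT1 (fun t => φ t) with hΦ
  have hPs : P = FourierTransform.fourier ψ := FT1_fourier ψ
  have hΦs : Φ = FourierTransform.fourier φ := FT1_fourier φ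
  have mΦ : Measurable Φ := by
    rw [hΦs]; exact (FourierTransform.fourier φ).continuous.measurable
  have mP : Measurable P := by
    rw [hPs]; exact (FourierTransform.fourier ψ).continuous.measurable
  set Q : ℝ → ℝ := fun u => (1 + u ^ 2) ^ (r / 2) * ‖Φ u‖ with hQ
  have hQ0 : ∀ u, 0 ≤ Q u := fun u => by simp only [hQ]; positivity
  have mQ : Measurable Q := by simp only [hQ]; fun_prop
  have hQsq : ∀ u, Q u ^ 2 = (1 + u ^ 2) ^ r * ‖Φ u‖ ^ 2 := by
    intro u
    have h0 : (0 : ℝ) < 1 + u ^ 2 := by positivity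
    simp only [hQ]
    rw [mul_pow, ← Real.rpow_natCast, ← Real.rpow_mul h0.le]
    congr 2; push_cast; ring
  have hQint : Integrable (fun u => Q u ^ 2) := by
    simp_rw [hQsq, hΦs]
    exact schwartz_weight_sq_int r _
  -- the representation of P
  have hrep : ∀ t, (c₀ : ℂ) * P t = ∫ ω, (κ ω : ℂ) * Φ (t - Ξ ω) ∂ρ := by
    intro t
    have e1 : ∀ τ : ℝ, (c₀ : ℂ) * (ch (-(τ * t)) * ψ τ) =
        ∫ ω, (κ ω : ℂ) * (ch (-(τ * (t - Ξ ω))) * φ τ) ∂ρ := by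
      intro τ
      have h0 : (0 : ℝ) < 1 + τ ^ 2 := by positivity
      have e2 : ∀ ω, (κ ω : ℂ) * (ch (-(τ * (t - Ξ ω))) * φ τ) =
          ((κ ω : ℂ) * ch (Ξ ω * τ)) * (ch (-(τ * t)) * φ τ) := by
        intro ω
        have : ch (-(τ * (t - Ξ ω))) = ch (Ξ ω * τ) * ch (-(τ * t)) := by
          rw [← ch_add]; congr 1; ring
        rw [this]; ring
      simp_rw [e2]
      rw [integral_mul_const, hM, hφ]
      have e3 : ((1 + τ ^ 2) ^ (-(s / 2)) : ℝ) * ((1 + τ ^ 2) ^ (s / 2) : ℝ) = 1 := by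
        rw [← Real.rpow_add h0]; simp
      have e4 : (((1 + τ ^ 2) ^ (-(s / 2)) : ℝ) : ℂ) * (((1 + τ ^ 2) ^ (s / 2) : ℝ) : ℂ) = 1 := by
        exact_mod_cast e3
      push_cast at e4 ⊢
      linear_combination (-(c₀ : ℂ) * ch (-(τ * t)) * ψ τ) * e4
    rw [hP, FT1_eq, ← integral_const_mul]
    simp_rw [e1]
    rw [integral_integral_swap]
    · congr 1; ext ω
      rw [integral_const_mul, hΦ, FT1_eq]
    · have h := (φ.integrable (μ := volume)).mul_prod (hκint.ofReal (𝕜 := ℂ))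
      refine (h.bdd_mul (c := 1) (f := fun z : ℝ × Ω => ch (-(z.1 * (t - Ξ z.2)))) ?_ ?_).congr ?_
      · exact (ch_meas.comp (by fun_prop)).aestronglyMeasurable
      · exact Eventually.of_forall fun z => (ch_norm _).le
      · refine Eventually.of_forall fun z => ?_
        simp only [Function.uncurry]
        have : ((RCLike.ofReal (κ z.2) : ℂ)) = (κ z.2 : ℂ) := rfl
        rw [this]; ring
  set k' : Ω → ℝ := fun ω => κ ω * (1 + Ξ ω ^ 2) ^ (r / 2) with hk'
  have mk' : Measurable k' := by simp only [hk']; fun_prop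
  have hk0 : ∀ ω, 0 ≤ k' ω := fun ω => mul_nonneg (hκ ω) (by positivity)
  -- pointwise estimate
  have hpt : ∀ t, ENNReal.ofReal (c₀ * ((1 + t ^ 2) ^ ((r + ℓ - 1) / 2) * ‖P t‖)) ≤
      ∫⁻ ω, ENNReal.ofReal (2 ^ (r / 2)) * (ENNReal.ofReal (k' ω) * (ENNReal.ofReal (A t) * ENNReal.ofReal (Q (t - Ξ ω)))) ∂ρ := by
    intro t
    have h0 : (0 : ℝ) < 1 + t ^ 2 := by positivity
    have e1 : c₀ * ((1 + t ^ 2) ^ ((r + ℓ - 1) / 2) * ‖P t‖) =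
        (A t * (1 + t ^ 2) ^ (r / 2)) * ‖(c₀ : ℂ) * P t‖ := by
      simp only [hA]
      rw [← Real.rpow_add h0, norm_mul, Complex.norm_real, Real.norm_eq_abs, abs_of_pos hc,
        show (ℓ - 1) / 2 + r / 2 = (r + ℓ - 1) / 2 by ring]
      ring
    rw [e1, ENNReal.ofReal_mul (mul_nonneg (hA0 t) (by positivity)), ofReal_norm, hrep t]
    calc _ ≤ ENNReal.ofReal (A t * (1 + t ^ 2) ^ (r / 2)) * ∫⁻ ω, ‖(κ ω : ℂ) * Φ (t - Ξ ω)‖ₑ ∂ρ := by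
          gcongr
          exact enorm_integral_le_lintegral_enorm _
      _ = ∫⁻ ω, ENNReal.ofReal (A t * (1 + t ^ 2) ^ (r / 2)) * ‖(κ ω : ℂ) * Φ (t - Ξ ω)‖ₑ ∂ρ := by
          rw [lintegral_const_mul]
          fun_prop
      _ ≤ _ := by
          apply lintegral_mono
          intro ω
          simp only
          rw [← ofReal_norm, ← ENNReal.ofReal_mul (mul_nonneg (hA0 t) (by positivity)),
            ← ENNReal.ofReal_mul (hA0 t), ← ENNReal.ofReal_mul (hk0 ω), ← ENNReal.ofReal_mul (by positivity)]
          apply ENNReal.ofReal_le_ofReal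
          rw [norm_mul, Complex.norm_real, Real.norm_eq_abs, abs_of_nonneg (hκ ω)]
          have hp := aux_peetre r t (Ξ ω) hr
          calc A t * (1 + t ^ 2) ^ (r / 2) * (κ ω * ‖Φ (t - Ξ ω)‖)
              ≤ A t * (2 ^ (r / 2) * (1 + Ξ ω ^ 2) ^ (r / 2) * (1 + (t - Ξ ω) ^ 2) ^ (r / 2)) * (κ ω * ‖Φ (t - Ξ ω)‖) := by
                have := hA0 t
                have := hκ ω
                gcongr
            _ = _ := by simp only [hk', hQ]; ring
  have hall : ∫⁻ t, ENNReal.ofReal (c₀ * ((1 + t ^ 2) ^ ((r + ℓ - 1) / 2) * ‖P t‖)) ≤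
      ENNReal.ofReal (2 ^ (r / 2)) * (ENNReal.ofReal K * (ENNReal.ofReal A2 ^ (1 / 2 : ℝ) *
        ENNReal.ofReal (∫ u, Q u ^ 2) ^ (1 / 2 : ℝ))) := by
    refine (lintegral_mono hpt).trans ?_
    rw [lintegral_lintegral_swap]
    · have inner : ∀ ω, ∫⁻ t, ENNReal.ofReal (2 ^ (r / 2)) * (ENNReal.ofReal (k' ω) * (ENNReal.ofReal (A t) * ENNReal.ofReal (Q (t - Ξ ω))))
          ≤ ENNReal.ofReal (2 ^ (r / 2)) * (ENNReal.ofReal (k' ω) * (ENNReal.ofReal A2 ^ (1 / 2 : ℝ) *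
        ENNReal.ofReal (∫ u, Q u ^ 2) ^ (1 / 2 : ℝ))) := by
        intro ω
        rw [lintegral_const_mul _ (by fun_prop), lintegral_const_mul _ (by fun_prop)]
        gcongr
        refine (cs_ineq A (fun t => Q (t - Ξ ω)) hA0 (fun t => hQ0 _) mA (by fun_prop)).trans_eq ?_
        congr 2
        · rw [hA2, ofReal_integral_eq_lintegral_ofReal hAint (Eventually.of_forall fun t => by positivity)]
        · rw [ofReal_integral_eq_lintegral_ofReal hQint (Eventually.of_forall fun t => by positivity)]
          exact lintegral_sub_right_eq_self (fun u => ENNReal.ofReal (Q u ^ 2)) (Ξ ω)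
      refine (lintegral_mono inner).trans_eq ?_
      rw [lintegral_const_mul _ (by fun_prop), lintegral_mul_const _ (by fun_prop), hK,
        ofReal_integral_eq_lintegral_ofReal hintg (Eventually.of_forall hk0)]
    · apply Measurable.aemeasurable
      fun_prop
  have hPint : Integrable (fun t : ℝ => c₀ * ((1 + t ^ 2) ^ ((r + ℓ - 1) / 2) * ‖P t‖)) := by
    rw [hPs]; exact (schwartz_weight_int _ _).const_mul _
  have hQI0 : 0 ≤ ∫ u, Q u ^ 2 := integral_nonneg fun t => by positivity
  rw [← ofReal_integral_eq_lintegral_ofReal hPint (Eventually.of_forall fun t => by positivity),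
    ENNReal.ofReal_rpow_of_nonneg hA20 (by norm_num), ENNReal.ofReal_rpow_of_nonneg hQI0 (by norm_num),
    ← ENNReal.ofReal_mul (by positivity), ← ENNReal.ofReal_mul (by positivity),
    ← ENNReal.ofReal_mul (by positivity), ENNReal.ofReal_le_ofReal_iff (by positivity),
    integral_const_mul] at hall
  simp_rw [hQsq] at hall
  rw [mul_assoc, le_inv_mul_iff₀ hc]
  refine hall.trans_eq (by ring)
lemma gauss_ft (x : ℝ) : ∫ η : ℝ, ((Real.exp (-π * η ^ 2) : ℝ) : ℂ) * ch (η * x)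
    = ((Real.exp (-π * x ^ 2) : ℝ) : ℂ) := by
  have h := congrFun (fourier_gaussian_pi (b := 1) (by simp)) (-x)
  rw [Real.fourier_eq'] at h
  simp only [smul_eq_mul, mul_one, Complex.one_cpow, div_one, one_mul] at h
  push_cast
  rw [show -(π : ℂ) * (x : ℂ) ^ 2 = -(π : ℂ) * (((-x : ℝ) : ℂ)) ^ 2 by push_cast; ring, ← h]
  congr 1; ext η
  rw [mul_comm, ch]
  congr 2
  simp
  ring

lemma mult_exists (r s ℓ : ℝ) (hr : 0 ≤ r) (hs : 0 < s) (hℓ : ℓ < 1 / 2) :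
    ∃ C : ℝ, 0 ≤ C ∧ ∀ ψ φ : SchwartzMap ℝ ℂ, (∀ t, φ t = (((1 + t ^ 2) ^ (s / 2) : ℝ) : ℂ) * ψ t) →
      ∫ t : ℝ, (1 + t ^ 2) ^ ((r + ℓ - 1) / 2) * ‖FT1 (fun t => ψ t) t‖ ≤
        C * (∫ ξ : ℝ, (1 + ξ ^ 2) ^ r * ‖FT1 (fun t => φ t) ξ‖ ^ 2) ^ (1 / 2 : ℝ) := by
  have hpi := Real.pi_gt_three
  obtain ⟨C, hC, hexp⟩ := aux_rpow_le_exp (r / 2) 1 one_pos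
  set g : ℝ → ℝ := fun x => indicator (Ioi 0) (fun x => x ^ (s / 2 - 1) * Real.exp (-(π * x))) x with hg
  set h : ℝ → ℝ := fun η => Real.exp (-π * η ^ 2) with hh
  have mg : Measurable g := by
    apply Measurable.indicator _ measurableSet_Ioi
    fun_prop
  have mh : Measurable h := by simp only [hh]; fun_prop
  have hg0 : ∀ x, 0 ≤ g x := by
    intro x
    apply indicator_nonneg
    intro x hx
    have : 0 < x := hx
    positivity
  have hh0 : ∀ x, 0 ≤ h x := fun x => (Real.exp_pos _).le
  have gzero : ∀ x, x ≤ 0 → g x = 0 := fun x hx => indicator_of_notMem (by simpa using hx) _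
  have gpos : ∀ x, 0 < x → g x = x ^ (s / 2 - 1) * Real.exp (-(π * x)) :=
    fun x hx => indicator_of_mem (by simpa using hx) _
  -- moments
  have ig : Integrable (fun x => g x * Real.exp (max x 0)) := by
    have := (aux_int_s17 (s / 2) (π - 1) (by linarith) (by linarith))
    rw [← integrable_indicator_iff measurableSet_Ioi] at this
    refine this.congr (Eventually.of_forall fun x => ?_)
    rcases le_or_gt x 0 with hx | hx
    · simp only [gzero x hx, zero_mul]
      exact indicator_of_notMem (by simpa using hx) _
    · simp only [gpos x hx]
      rw [indicator_of_mem (by simpa using hx), max_eq_left hx.le, mul_assoc, ← Real.exp_add]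
      congr 2; ring
  have ih : Integrable (fun η => h η * Real.exp (η ^ 2)) := by
    have := integrable_exp_neg_mul_sq (b := π - 1) (by linarith)
    refine this.congr (Eventually.of_forall fun x => ?_)
    simp only [hh]
    rw [← Real.exp_add]; congr 1; ring
  have ig0 : Integrable g := by
    have := (aux_int_s17 (s / 2) π (by linarith) (by linarith))
    rwa [← integrable_indicator_iff measurableSet_Ioi] at this
  have ih0 : Integrable h := by
    exact integrable_exp_neg_mul_sq (b := π) (by linarith)
  refine mult_est (volume.prod volume : Measure (ℝ × ℝ)) (fun z => g z.1 * h z.2)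
    (fun z => √z.1 * z.2) (fun z => mul_nonneg (hg0 _) (hh0 _)) (by fun_prop) (by fun_prop) r s
    ((1 / π) ^ (s / 2) * Real.Gamma (s / 2)) ℓ hr ?_ hℓ ?_ ?_
  · have := Real.Gamma_pos_of_pos (half_pos hs)
    positivity
  · refine Integrable.mono' ((ig.mul_prod ih).const_mul (C * C)) (by fun_prop)
      (Eventually.of_forall fun z => ?_)
    have p1 := hg0 z.1
    have p2 := hh0 z.2
    rw [Real.norm_eq_abs, abs_of_nonneg (by positivity)]
    have e1 : (1 + (√z.1 * z.2) ^ 2) ^ (r / 2) ≤ (1 + max z.1 0) ^ (r / 2) * (1 + z.2 ^ 2) ^ (r / 2) := by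
      have hm : 0 ≤ max z.1 0 := le_max_right _ _
      rw [← Real.mul_rpow (by positivity) (by positivity)]
      apply Real.rpow_le_rpow (by positivity) _ (by positivity)
      have : √z.1 ^ 2 = max z.1 0 := by
        rcases le_total z.1 0 with h | h
        · rw [max_eq_right h, Real.sqrt_eq_zero_of_nonpos h]; simp
        · rw [max_eq_left h, Real.sq_sqrt h]
      rw [mul_pow, this]
      nlinarith [sq_nonneg z.2, mul_nonneg hm (sq_nonneg z.2)]
    have e2 := hexp (max z.1 0) (le_max_right _ _)
    have e3 := hexp (z.2 ^ 2) (sq_nonneg _)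
    rw [one_mul] at e2 e3
    calc g z.1 * h z.2 * (1 + (√z.1 * z.2) ^ 2) ^ (r / 2)
        ≤ g z.1 * h z.2 * ((C * Real.exp (max z.1 0)) * (C * Real.exp (z.2 ^ 2))) := by
          gcongr
          exact e1.trans (by gcongr)
      _ = _ := by ring
  · intro τ
    have hi : Integrable (fun z : ℝ × ℝ => (((g z.1 * h z.2 : ℝ)) : ℂ) * ch (√z.1 * z.2 * τ))
        (volume.prod volume) := by
      refine ((ig0.mul_prod ih0).ofReal (𝕜 := ℂ)).mul_bdd (c := 1) ?_
        (Eventually.of_forall fun z => (ch_norm _).le)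
      exact (ch_meas.comp (by fun_prop)).aestronglyMeasurable
    rw [integral_prod _ hi]
    have e1 : ∀ x : ℝ, ∫ η : ℝ, (((g x * h η : ℝ)) : ℂ) * ch (√x * η * τ) =
        ((indicator (Ioi 0) (fun x => x ^ (s / 2 - 1) * Real.exp (-(π * (1 + τ ^ 2) * x))) x : ℝ) : ℂ) := by
      intro x
      have : ∀ η : ℝ, (((g x * h η : ℝ)) : ℂ) * ch (√x * η * τ) =
          (g x : ℂ) * (((Real.exp (-π * η ^ 2) : ℝ) : ℂ) * ch (η * (√x * τ))) := by
        intro η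
        rw [show √x * η * τ = η * (√x * τ) by ring, Complex.ofReal_mul]
        ring
      simp_rw [this]
      rw [integral_const_mul, gauss_ft, ← Complex.ofReal_mul]
      congr 1
      rcases le_or_gt x 0 with hx | hx
      · rw [gzero x hx, zero_mul]
        exact (indicator_of_notMem (by simpa using hx) _).symm
      · rw [gpos x hx, indicator_of_mem (by simpa using hx), mul_assoc, ← Real.exp_add, mul_pow,
          Real.sq_sqrt hx.le]
        congr 2; ring
    simp_rw [e1]
    rw [integral_complex_ofReal, integral_indicator measurableSet_Ioi,
      Real.integral_rpow_mul_exp_neg_mul_Ioi (by linarith) (by positivity)]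
    congr 1
    rw [one_div, one_div, Real.inv_rpow (by positivity), Real.inv_rpow (by positivity),
      Real.mul_rpow (by positivity) (by positivity), Real.rpow_neg (by positivity)]
    field_simp

lemma sup_exists (r s : ℝ) (hr : 0 ≤ r) (hs : 1 / 2 < s) :
    ∃ C : ℝ, 0 ≤ C ∧ ∀ ψ φ : SchwartzMap ℝ ℂ, (∀ t, φ t = (((1 + t ^ 2) ^ (s / 2) : ℝ) : ℂ) * ψ t) →
      ∀ t, ‖FT1 (fun t => ψ t) t‖ ≤
        C * (∫ ξ : ℝ, (1 + ξ ^ 2) ^ r * ‖FT1 (fun t => φ t) ξ‖ ^ 2) ^ (1 / 2 : ℝ) := by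
  set A : ℝ → ℝ := fun t => (1 + t ^ 2) ^ (-s / 2) with hA
  have hA0 : ∀ t, 0 ≤ A t := fun t => by simp only [hA]; positivity
  have mA : Measurable A := by simp only [hA]; fun_prop
  set A2 := ∫ t, A t ^ 2 with hA2
  have hAint : Integrable (fun t => A t ^ 2) := by
    refine (japanese_int s (by linarith)).congr (Eventually.of_forall fun t => ?_)
    have h0 : (0 : ℝ) < 1 + t ^ 2 := by positivity
    simp only [hA]
    rw [← Real.rpow_natCast ((1 + t ^ 2) ^ (-s / 2)) 2, ← Real.rpow_mul h0.le]
    congr 1; push_cast; ring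
  have hA20 : 0 ≤ A2 := integral_nonneg fun t => by positivity
  refine ⟨A2 ^ (1 / 2 : ℝ), by positivity, fun ψ φ hφ t => ?_⟩
  have hφ2 : Integrable (fun t => ‖φ t‖ ^ 2) := by
    simpa using schwartz_weight_sq_int 0 φ
  have e1 : ‖FT1 (fun t => ψ t) t‖ ≤ ∫ τ, ‖ψ τ‖ := by
    rw [FT1_eq]
    refine (norm_integral_le_integral_norm _).trans_eq ?_
    congr 1; ext τ; rw [norm_mul, ch_norm, one_mul]
  have e2 : ∀ τ, ‖ψ τ‖ = A τ * ‖φ τ‖ := by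
    intro τ
    have h0 : (0 : ℝ) < 1 + τ ^ 2 := by positivity
    have h1 : 0 < (1 + τ ^ 2) ^ (s / 2) := by positivity
    rw [hφ, norm_mul, Complex.norm_real, Real.norm_eq_abs, abs_of_pos h1]
    simp only [hA]
    rw [← mul_assoc, ← Real.rpow_add h0]
    simp [show -s / 2 + s / 2 = 0 by ring]
  have e3 : ∫ τ, ‖ψ τ‖ ≤ A2 ^ (1 / 2 : ℝ) * (∫ τ, ‖φ τ‖ ^ 2) ^ (1 / 2 : ℝ) := by
    have h := cs_ineq A (fun t => ‖φ t‖) hA0 (fun t => norm_nonneg _) mA φ.continuous.norm.measurable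
    have hφ20 : 0 ≤ ∫ τ, ‖φ τ‖ ^ 2 := integral_nonneg fun t => by positivity
    rw [← ofReal_integral_eq_lintegral_ofReal hAint (Eventually.of_forall fun t => by positivity),
      ← ofReal_integral_eq_lintegral_ofReal hφ2 (Eventually.of_forall fun t => by positivity),
      ENNReal.ofReal_rpow_of_nonneg hA20 (by norm_num), ENNReal.ofReal_rpow_of_nonneg hφ20 (by norm_num),
      ← ENNReal.ofReal_mul (by positivity)] at h
    simp_rw [← ENNReal.ofReal_mul (hA0 _), ← e2] at h
    rw [← ofReal_integral_eq_lintegral_ofReal ψ.integrable.norm (Eventually.of_forall fun t => by positivity),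
      ENNReal.ofReal_le_ofReal_iff (by positivity)] at h
    exact h
  have e4 : ∫ τ, ‖φ τ‖ ^ 2 ≤ ∫ ξ : ℝ, (1 + ξ ^ 2) ^ r * ‖FT1 (fun t => φ t) ξ‖ ^ 2 := by
    rw [← SchwartzMap.integral_norm_sq_fourier, FT1_fourier]
    apply integral_mono
    · simpa using schwartz_weight_sq_int 0 (FourierTransform.fourier φ)
    · exact schwartz_weight_sq_int r (FourierTransform.fourier φ)
    · intro ξ
      simp only
      have : 1 ≤ (1 + ξ ^ 2) ^ r := Real.one_le_rpow (by nlinarith [sq_nonneg ξ]) hr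
      nlinarith [sq_nonneg ‖FourierTransform.fourier φ ξ‖]
  refine e1.trans (e3.trans ?_)
  have : 0 ≤ ∫ τ, ‖φ τ‖ ^ 2 := integral_nonneg fun t => by positivity
  gcongr

/-- the weight of the Fourier side kernel -/
noncomputable def Wt (a t : ℝ) : ℝ := |t| ^ (a - 1) + (|t| + 1) ^ (a - 1)

lemma Wt_bd (a : ℝ) : ∃ C : ℝ, 0 ≤ C ∧ ∀ t, 1 < |t| → Wt a t ≤ C * (1 + t ^ 2) ^ ((a - 1) / 2) := by
  have key : ∀ u x y : ℝ, 0 < x → 0 < y → x ≤ 2 * y → y ≤ 2 * x → x ^ u ≤ 2 ^ |u| * y ^ u := by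
    intro u x y hx hy h1 h2
    rcases le_total 0 u with hu | hu
    · rw [abs_of_nonneg hu, ← Real.mul_rpow (by norm_num) hy.le]
      exact Real.rpow_le_rpow hx.le h1 hu
    · have : x ^ u ≤ (y / 2) ^ u := Real.rpow_le_rpow_of_nonpos (by positivity) (by linarith) hu
      refine this.trans_eq ?_
      rw [abs_of_nonpos hu, Real.div_rpow hy.le (by norm_num), Real.rpow_neg (by norm_num)]
      field_simp
  refine ⟨2 * 2 ^ |a - 1|, by positivity, fun t ht => ?_⟩
  have h0 : (0 : ℝ) < 1 + t ^ 2 := by positivity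
  have e : (1 + t ^ 2) ^ ((a - 1) / 2) = (√(1 + t ^ 2)) ^ (a - 1) := by
    rw [Real.sqrt_eq_rpow, ← Real.rpow_mul h0.le]; congr 1; ring
  have hy : 0 < √(1 + t ^ 2) := by positivity
  have s1 : √(1 + t ^ 2) ≤ 2 * |t| := by
    apply Real.sqrt_le_iff.2 ⟨by positivity, _⟩
    rw [mul_pow, sq_abs]
    nlinarith [sq_abs t]
  have s2 : |t| ≤ √(1 + t ^ 2) := by
    apply Real.le_sqrt_of_sq_le; rw [sq_abs]; linarith
  have s3 : 1 ≤ √(1 + t ^ 2) := by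
    apply Real.one_le_sqrt.2; nlinarith [sq_nonneg t]
  rw [e, Wt]
  have k1 := key (a - 1) |t| _ (by linarith) hy (by linarith) s1
  have k2 := key (a - 1) (|t| + 1) _ (by linarith) hy (by linarith) (by linarith)
  linarith

lemma Wt_int (a : ℝ) (ha : 0 < a) : IntegrableOn (Wt a) (Icc (-1) 1) := by
  have h1 : IntegrableOn (fun t : ℝ => |t| ^ (a - 1)) (Icc (-1) 1) := by
    have hp : IntegrableOn (fun t : ℝ => t ^ (a - 1)) (Ioc 0 1) := by
      have := intervalIntegral.intervalIntegrable_rpow' (a := 0) (b := 1) (r := a - 1) (by linarith)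
      rwa [intervalIntegrable_iff_integrableOn_Ioc_of_le zero_le_one] at this
    have hp2 : IntegrableOn (fun t : ℝ => |t| ^ (a - 1)) (Ioc 0 1) :=
      hp.congr_fun (fun t ht => by simp only [abs_of_pos ht.1]) measurableSet_Ioc
    have hp3 : IntegrableOn (fun t : ℝ => |t| ^ (a - 1)) (Ico (-1) 0) := by
      have := hp2.integrable_indicator measurableSet_Ioc
      have h2 := this.comp_neg
      rw [← integrable_indicator_iff measurableSet_Ico]
      refine h2.congr (Eventually.of_forall fun t => ?_)
      simp only
      by_cases ht : t ∈ Ico (-1 : ℝ) 0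
      · rw [indicator_of_mem ht, indicator_of_mem (by constructor <;> linarith [ht.1, ht.2]), abs_neg]
      · rw [indicator_of_notMem ht, indicator_of_notMem]
        intro h
        apply ht
        constructor <;> linarith [h.1, h.2]
    have hp4 : IntegrableOn (fun t : ℝ => |t| ^ (a - 1)) {0} := by simp
    refine (hp3.union (hp4.union hp2)).mono_set fun t ht => ?_
    rcases lt_trichotomy t 0 with h | h | h
    · left; exact ⟨ht.1, h⟩
    · right; left; exact h
    · right; right; exact ⟨h, ht.2⟩
  apply h1.add
  apply ContinuousOn.integrableOn_Icc
  apply ContinuousOn.rpow_const (by fun_prop)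
  intro t _
  left
  positivity

lemma weight_exists (a ℓ s : ℝ) (ha : 0 < a) (hℓ : ℓ < 1 / 2) (hℓa : ℓ ≤ a) (hs : 1 / 2 < s) :
    ∃ C : ℝ, 0 ≤ C ∧ ∀ ψ : SchwartzMap ℝ ℂ,
      Integrable (fun t => Wt a t * ‖FT1 (fun t => ψ t) t‖) ∧
      ∫ t, Wt a t * ‖FT1 (fun t => ψ t) t‖ ≤ C * wSobNorm (a - ℓ) s (fun t => ψ t) := by
  obtain ⟨C1, hC1, h1⟩ := mult_exists (a - ℓ) s ℓ (by linarith) (by linarith) hℓ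
  obtain ⟨C2, hC2, h2⟩ := sup_exists (a - ℓ) s (by linarith) hs
  obtain ⟨C3, hC3, h3⟩ := Wt_bd a
  have hW0 : ∀ t, 0 ≤ Wt a t := fun t => by unfold Wt; positivity
  have mW : Measurable (Wt a) := by unfold Wt; fun_prop
  set J := ∫ t in Icc (-1 : ℝ) 1, Wt a t with hJ
  have hJ0 : 0 ≤ J := integral_nonneg hW0
  refine ⟨J * C2 + C3 * C1, by positivity, fun ψ => ?_⟩
  obtain ⟨φ, hφ⟩ := exists_phi s ψ
  have hN : wSobNorm (a - ℓ) s (fun t => ψ t) =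
      (∫ ξ : ℝ, (1 + ξ ^ 2) ^ (a - ℓ) * ‖FT1 (fun t => φ t) ξ‖ ^ 2) ^ (1 / 2 : ℝ) := by
    unfold wSobNorm
    simp_rw [hφ]
  have g1 := h1 ψ φ hφ
  have g2 := h2 ψ φ hφ
  rw [← hN] at g1 g2
  rw [show (a - ℓ + ℓ - 1) = a - 1 by ring] at g1
  set N := wSobNorm (a - ℓ) s (fun t => ψ t)
  set P := FT1 (fun t => ψ t) with hP
  have hPs : P = FourierTransform.fourier ψ := FT1_fourier ψ
  have mP : Measurable P := by
    rw [hPs]; exact (FourierTransform.fourier ψ).continuous.measurable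
  have i1 : Integrable (indicator (Icc (-1 : ℝ) 1) (Wt a)) :=
    (Wt_int a ha).integrable_indicator measurableSet_Icc
  have i2 : Integrable (fun t : ℝ => (1 + t ^ 2) ^ ((a - 1) / 2) * ‖P t‖) := by
    rw [hPs]; exact schwartz_weight_int _ _
  have hb : ∀ t, Wt a t * ‖P t‖ ≤ indicator (Icc (-1 : ℝ) 1) (Wt a) t * (C2 * N) +
      C3 * ((1 + t ^ 2) ^ ((a - 1) / 2) * ‖P t‖) := by
    intro t
    have p : 0 ≤ C3 * ((1 + t ^ 2) ^ ((a - 1) / 2) * ‖P t‖) := by positivity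
    by_cases ht : t ∈ Icc (-1 : ℝ) 1
    · rw [indicator_of_mem ht]
      have := mul_le_mul_of_nonneg_left (g2 t) (hW0 t)
      linarith
    · rw [indicator_of_notMem ht, zero_mul, zero_add, ← mul_assoc]
      gcongr
      apply h3
      by_contra! h
      exact ht (abs_le.1 h)
  have i3 := (i1.mul_const (C2 * N)).add (i2.const_mul C3)
  have i4 : Integrable (fun t => Wt a t * ‖P t‖) := by
    refine i3.mono' (by fun_prop) (Eventually.of_forall fun t => ?_)
    rw [Real.norm_eq_abs, abs_of_nonneg (mul_nonneg (hW0 t) (norm_nonneg _))]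
    exact hb t
  refine ⟨i4, (integral_mono i4 i3 hb).trans ?_⟩
  simp only [Pi.add_apply]
  rw [integral_add (i1.mul_const (C2 * N)) (i2.const_mul C3), integral_mul_const, integral_const_mul,
    integral_indicator measurableSet_Icc, ← hJ]
  have := mul_le_mul_of_nonneg_left g1 hC3
  linarith

lemma Vk_meas (α μ : ℂ) : Measurable (Vk α μ) := by
  unfold Vk
  apply Measurable.mul (by fun_prop)
  apply Measurable.const_mul
  have : StronglyMeasurable (fun z : ℝ × ℝ => kern α (α - 1) |z.1| (4 * π * Complex.I * μ) (1 - Complex.I) z.2) := by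
    apply Measurable.stronglyMeasurable
    unfold kern
    fun_prop
  exact (this.integral_prod_right (ν := volume.restrict (Ioi (0 : ℝ)))).measurable
theorem stmt17 (m : ℝ) (hm : 0 < m) (α : ℂ) (hα : 0 < α.re)
    (ℓ s₁ : ℝ) (hℓ0 : 0 ≤ ℓ) (hℓ : ℓ < 1 / 2) (hℓα : ℓ ≤ α.re) (hs₁ : 1 / 2 < s₁) :
    ∃ C : ℝ, 0 ≤ C ∧ ∀ lam : ℝ, 1 ≤ lam → ∀ ψ : SchwartzMap ℝ ℂ,
      ∃ L : ℂ,
        Tendsto (fun ε : ℝ =>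
            ∫ τ : ℝ, (-(τ : ℂ) ^ 2 + (lam : ℂ) + (m : ℂ) ^ 2 - Complex.I * (ε : ℂ)) ^ (-α)
              * ψ τ)
          (𝓝[>] (0 : ℝ)) (𝓝 L) ∧
        ‖L‖ ≤ C * lam ^ (-(α.re) / 2) * wSobNorm (α.re - ℓ) s₁ (fun t => ψ t) := by
  obtain ⟨C1, hC1, h1⟩ := Vk_bd α hα
  obtain ⟨C2, hC2, h2⟩ := weight_exists α.re ℓ s₁ hα hℓ hℓα hs₁
  refine ⟨‖cst α‖ * (C1 * C2), by positivity, fun lam hlam ψ => ?_⟩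
  obtain ⟨hI, hB⟩ := h2 ψ
  set P := FT1 (fun t => ψ t) with hP
  have mP : Measurable P := by
    rw [hP, FT1_fourier]; exact (FourierTransform.fourier ψ).continuous.measurable
  set Lam : ℝ := lam + m ^ 2 with hLam
  have hLam0 : 0 < Lam := by positivity
  -- the square root
  set μ : ℝ → ℂ := fun ε => ((Lam : ℂ) - Complex.I * ε) ^ (1 / 2 : ℂ) with hμ
  have hsl : ∀ ε : ℝ, (Lam : ℂ) - Complex.I * ε ∈ Complex.slitPlane := by
    intro ε; left; simpa using hLam0
  have hne : ∀ ε : ℝ, (Lam : ℂ) - Complex.I * ε ≠ 0 := fun ε => Complex.slitPlane_ne_zero (hsl ε)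
  have hsq : ∀ ε, μ ε ^ 2 = (Lam : ℂ) - Complex.I * ε := by
    intro ε
    simp only [hμ]
    rw [← Complex.cpow_nat_mul]
    norm_num
  have hre0 : ∀ ε, 0 < (μ ε).re := by
    intro ε
    simp only [hμ]
    rw [Complex.cpow_def_of_ne_zero (hne ε), Complex.exp_re]
    apply mul_pos (Real.exp_pos _)
    apply Real.cos_pos_of_mem_Ioo
    have e : (Complex.log ((Lam : ℂ) - Complex.I * ε) * (1 / 2)).im
        = ((Lam : ℂ) - Complex.I * ε).arg / 2 := by
      rw [show (1 / 2 : ℂ) = ((1 / 2 : ℝ) : ℂ) by push_cast; rfl, Complex.im_mul_ofReal, Complex.log_im]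
      ring
    rw [e]
    have := Complex.abs_arg_le_pi ((Lam : ℂ) - Complex.I * ε)
    have h3 := abs_lt.1 (Complex.abs_arg_lt_pi_div_two_iff.2 (Or.inl
      (show 0 < ((Lam : ℂ) - Complex.I * ε).re by simpa using hLam0)))
    have := Real.pi_pos
    constructor <;> linarith [h3.1, h3.2]
  have hre2 : ∀ ε, (μ ε).re ^ 2 - (μ ε).im ^ 2 = Lam := by
    intro ε
    have := congrArg Complex.re (hsq ε)
    rw [pow_two] at this
    simp at this
    linarith
  have him2 : ∀ ε, 2 * ((μ ε).re * (μ ε).im) = -ε := by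
    intro ε
    have := congrArg Complex.im (hsq ε)
    rw [pow_two] at this
    simp at this
    linarith
  have hre : ∀ ε, √lam ≤ (μ ε).re := by
    intro ε
    apply Real.sqrt_le_iff.2 ⟨(hre0 ε).le, _⟩
    nlinarith [hre2 ε, sq_nonneg (μ ε).im, sq_nonneg m]
  have him : ∀ ε, 0 < ε → (μ ε).im < 0 := by
    intro ε hε
    by_contra! h
    have := mul_nonneg (hre0 ε).le h
    linarith [him2 ε]
  have him0 : (μ 0).im ≤ 0 := by
    by_contra! h
    have := mul_pos (hre0 0) h
    linarith [him2 0]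
  have hcont : Tendsto μ (𝓝[>] 0) (𝓝 (μ 0)) := by
    have : ContinuousAt μ 0 := by
      simp only [hμ]
      exact ContinuousAt.cpow (by fun_prop) continuousAt_const (hsl 0)
    exact this.tendsto.mono_left nhdsWithin_le_nhds
  have hne0 : ∀ᵐ t : ℝ, t ≠ 0 := by simp [ae_iff, measure_singleton]
  have hbound : ∀ ε, (μ ε).im ≤ 0 → ∀ t, t ≠ 0 →
      ‖Vk α (μ ε) t * P t‖ ≤ C1 * lam ^ (-α.re / 2) * (Wt α.re t * ‖P t‖) := by
    intro ε hε t ht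
    rw [norm_mul, ← mul_assoc]
    gcongr
    exact h1 lam (μ ε) t hlam (hre ε) hε ht
  refine ⟨cst α * ∫ t, Vk α (μ 0) t * P t, ?_, ?_⟩
  · have ht : Tendsto (fun ε => cst α * ∫ t, Vk α (μ ε) t * P t) (𝓝[>] 0)
        (𝓝 (cst α * ∫ t, Vk α (μ 0) t * P t)) := by
      apply Tendsto.const_mul
      refine tendsto_integral_filter_of_dominated_convergence
        (fun t => C1 * lam ^ (-α.re / 2) * (Wt α.re t * ‖P t‖))
        (Eventually.of_forall fun ε => ((Vk_meas α _).mul mP).aestronglyMeasurable) ?_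
        (hI.const_mul _) ?_
      · filter_upwards [self_mem_nhdsWithin] with ε hε
        filter_upwards [hne0] with t ht
        exact hbound ε (him ε hε).le t ht
      · filter_upwards [hne0] with t ht
        apply Tendsto.mul_const
        exact Vk_tendsto α hα lam hlam μ (μ 0) _ hcont (Eventually.of_forall hre)
          (by filter_upwards [self_mem_nhdsWithin] with ε hε using (him ε hε).le) t ht
    refine ht.congr' ?_
    filter_upwards [self_mem_nhdsWithin] with ε hε
    rw [← main_repr α (μ ε) hα (hre0 ε) (him ε hε) ψ]
    congr 1; ext τ
    rw [hsq ε, hLam]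
    congr 2
    push_cast; ring
  · have hn : ‖∫ t, Vk α (μ 0) t * P t‖ ≤
        C1 * lam ^ (-α.re / 2) * ∫ t, Wt α.re t * ‖P t‖ := by
      rw [← integral_const_mul]
      apply norm_integral_le_of_norm_le (hI.const_mul _)
      filter_upwards [hne0] with t ht
      exact hbound 0 him0 t ht
    rw [norm_mul]
    calc _ ≤ ‖cst α‖ * (C1 * lam ^ (-α.re / 2) * (C2 * wSobNorm (α.re - ℓ) s₁ (fun t => ψ t))) := by
          gcongr
          exact hn.trans (by gcongr)
      _ = _ := by ring
end
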